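/- arXiv:2406.17139 — 5 statements merged into one kernel-verified Lean document; each statement's English description precedes it below -/
import Mathlib

section
/- Let k be a field, d ≥ 2, S(d) = k[x_i, y_i, z_i : 0 ≤ i ≤ d−1], and K(d) the ideal generated by x_i y_{i+1} − y_i x_{i+1}, z_i x_{i+1}, z_i y_{i+1} for 0 ≤ i ≤ d−2. For i+j+l = d let m_{i,j,l} be the class in S(d)/K(d) of x_0⋯x_{i−1} y_i⋯y_{i+j−1} z_{i+j}⋯z_{d−1}. For 0 ≤ l ≤ d let R(d,l) be the k-subalgebra of S(d)/K(d) generated by {m_{i, d−i−j, j} : 0 ≤ j ≤ l, 0 ≤ i ≤ d−j}. For 0 ≤ l ≤ d define the ideal J(d,l) of S(d)/K(d) to be the ideal generated by {x_i, y_i : d−l+1 ≤ i ≤ d−1} if 2 ≤ l ≤ d, and the zero ideal if l ∈ {0,1}. Then the annihilator of m_{0,d−l,l} in R(d,l) equals the annihilator of m_{d−l,0,l} in R(d,l), and both equal J(d,l) ∩ R(d,l). -/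
open MvPolynomial

noncomputable section

variable (k : Type) [Field k] (d : ℕ)

/-- `S(d) = k[x_i, y_i, z_i : 0 ≤ i ≤ d-1]`, with `x_i = X (i,0)`, `y_i = X (i,1)`,
`z_i = X (i,2)`. -/
abbrev Sd := MvPolynomial (Fin d × Fin 3) k

def xv (i : Fin d) : Sd k d := X (i, 0)
def yv (i : Fin d) : Sd k d := X (i, 1)
def zv (i : Fin d) : Sd k d := X (i, 2)

/-- The multilinearization ideal
`K(d) = (x_i y_{i+1} − y_i x_{i+1}, z_i x_{i+1}, z_i y_{i+1} : 0 ≤ i ≤ d−2)`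
of the relations of `A = k⟨x,y,z⟩/⟨xy−yx, zx, zy⟩`. -/
def KK : Ideal (Sd k d) :=
  Ideal.span {p | ∃ (i : ℕ) (h : i + 1 < d),
    p = xv k d ⟨i, by omega⟩ * yv k d ⟨i + 1, h⟩ - yv k d ⟨i, by omega⟩ * xv k d ⟨i + 1, h⟩ ∨
    p = zv k d ⟨i, by omega⟩ * xv k d ⟨i + 1, h⟩ ∨
    p = zv k d ⟨i, by omega⟩ * yv k d ⟨i + 1, h⟩}

/-- `m_{i,j,l}` (with `l = d - i - j` implicit): the class in `S(d)/K(d)` of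
`x_0 ⋯ x_{i−1} · y_i ⋯ y_{i+j−1} · z_{i+j} ⋯ z_{d−1}`. -/
def mm (i j : ℕ) : Sd k d ⧸ KK k d :=
  Ideal.Quotient.mk (KK k d)
    (∏ t : Fin d, if (t : ℕ) < i then xv k d t else if (t : ℕ) < i + j then yv k d t
      else zv k d t)

/-- `R(d,l)`: the `k`-subalgebra of `S(d)/K(d)` generated by the elements
`m_{i, d−i−j, j}` for `0 ≤ j ≤ l`, `0 ≤ i ≤ d−j`. -/
def Rdl (l : ℕ) : Subalgebra k (Sd k d ⧸ KK k d) :=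
  Algebra.adjoin k {q | ∃ j : ℕ, j ≤ l ∧ ∃ i : ℕ, i ≤ d - j ∧ q = mm k d i (d - i - j)}

/-- `u_{d,l} = Σ_{i=0}^{l} m_{d−i,0,i}`. -/
def uu (l : ℕ) : Sd k d ⧸ KK k d := ∑ i ∈ Finset.range (l + 1), mm k d (d - i) 0

/-- `v_{d,l} = Σ_{j=0}^{l} m_{0,d−j,j}`. -/
def vv (l : ℕ) : Sd k d ⧸ KK k d := ∑ j ∈ Finset.range (l + 1), mm k d 0 (d - j)

end

/-- `J(d,l)`: for `2 ≤ l ≤ d`, the ideal of `S(d)/K(d)` generated by the classes of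
`x_i, y_i` for `d−l+1 ≤ i ≤ d−1`; the zero ideal for `l ∈ {0,1}`. -/
noncomputable def Jdl (k : Type) [Field k] (d l : ℕ) : Ideal (Sd k d ⧸ KK k d) :=
  if 2 ≤ l then
    Ideal.span {q | ∃ i : Fin d, d - l + 1 ≤ (i : ℕ) ∧
      (q = Ideal.Quotient.mk (KK k d) (xv k d i) ∨
       q = Ideal.Quotient.mk (KK k d) (yv k d i))}
  else ⊥

/-- Along a chain of `2 × n` columns with vanishing adjacent minors, the minor on the two end
columns is killed by any product with one entry from each column strictly in between. -/
lemma minor_mul_prod_eq_zero {R : Type*} [CommRing R] (x y t : ℕ → R)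
    (hrel : ∀ i, x i * y (i + 1) = y i * x (i + 1)) (ht : ∀ i, t i = x i ∨ t i = y i)
    (r n : ℕ) :
    (x r * y (r + n + 1) - y r * x (r + n + 1)) * ∏ i ∈ Finset.range n, t (r + 1 + i) = 0 := by
  induction n with
  | zero => simp [hrel]
  | succ n ih =>
    rw [Finset.prod_range_succ]
    have e : r + 1 + n = r + n + 1 := by ring
    have e' : r + (n + 1) + 1 = (r + n + 1) + 1 := by ring
    rw [e, e']
    have h := hrel (r + n + 1)
    set P := ∏ i ∈ Finset.range n, t (r + 1 + i)
    rcases ht (r + n + 1) with h1 | h1 <;> rw [h1]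
    · linear_combination (x (r + n + 1 + 1)) * ih + x r * P * h
    · linear_combination (y (r + n + 1 + 1)) * ih + y r * P * h

/-- The monomial `∏_{i<d} x_i^{f_i} y_i^{h_i}`. -/
def xyProd {R : Type*} [CommRing R] (x y : ℕ → R) (d : ℕ) (f h : ℕ → ℕ) : R :=
  ∏ i ∈ Finset.range d, (x i ^ f i * y i ^ h i)

lemma xyProd_add {R : Type*} [CommRing R] (x y : ℕ → R) (d : ℕ) (f h f' h' : ℕ → ℕ) :
    xyProd x y d (f + f') (h + h') = xyProd x y d f h * xyProd x y d f' h' := by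
  rw [xyProd, xyProd, xyProd, ← Finset.prod_mul_distrib]
  refine Finset.prod_congr rfl fun i _ => ?_
  simp only [Pi.add_apply, pow_add]
  ring

lemma xyProd_single {R : Type*} [CommRing R] (x y : ℕ → R) (d r s : ℕ) (hr : r < d)
    (hs : s < d) : xyProd x y d (Pi.single r 1) (Pi.single s 1) = x r * y s := by
  rw [xyProd, Finset.prod_mul_distrib, Finset.prod_eq_single r, Finset.prod_eq_single s]
  · simp
  · intro b _ hb; simp [hb]
  · intro h; simp [hs] at h
  · intro b _ hb; simp [hb]
  · intro h; simp [hr] at h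

lemma minor_mul_xyProd_of_lt {R : Type*} [CommRing R] (x y : ℕ → R)
    (hrel : ∀ i, x i * y (i + 1) = y i * x (i + 1)) (d : ℕ) (f h : ℕ → ℕ) (r s : ℕ)
    (hrs : r < s) (hs : s < d) (hpos : ∀ i, r < i → i < s → 0 < f i + h i) :
    (x r * y s - y r * x s) * xyProd x y d f h = 0 := by
  obtain ⟨n, rfl⟩ : ∃ n, s = r + n + 1 := ⟨s - r - 1, by omega⟩
  let t : ℕ → R := fun i => if 0 < f i then x i else y i
  have key := minor_mul_prod_eq_zero x y t hrel (fun i => by simp only [t]; split_ifs <;> simp) r n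
  have hdvd : (∏ i ∈ Finset.range n, t (r + 1 + i)) ∣ xyProd x y d f h := by
    have e : ∏ i ∈ Finset.range n, t (r + 1 + i) = ∏ i ∈ Finset.Ico (r + 1) (r + 1 + n), t i := by
      rw [Finset.prod_Ico_eq_prod_range]; simp
    rw [e]
    refine (Finset.prod_dvd_prod_of_dvd _ (fun i => x i ^ f i * y i ^ h i) ?_).trans
      (Finset.prod_dvd_prod_of_subset _ _ _ ?_)
    · intro i hi
      rw [Finset.mem_Ico] at hi
      have := hpos i (by omega) (by omega)
      simp only [t]
      split_ifs with h0
      · exact (dvd_pow_self _ h0.ne').mul_right _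
      · exact (dvd_pow_self _ (by omega)).mul_left _
    · intro i hi
      simp only [Finset.mem_Ico, Finset.mem_range] at hi ⊢
      omega
  obtain ⟨c, hc⟩ := hdvd
  rw [hc, ← mul_assoc, key, zero_mul]

lemma minor_mul_xyProd {R : Type*} [CommRing R] (x y : ℕ → R)
    (hrel : ∀ i, x i * y (i + 1) = y i * x (i + 1)) (d : ℕ) (f h : ℕ → ℕ) (r s : ℕ)
    (hr : r < d) (hs : s < d)
    (hpos : ∀ i, min r s < i → i < max r s → 0 < f i + h i) :
    (x r * y s - y r * x s) * xyProd x y d f h = 0 := by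
  rcases lt_trichotomy r s with h1 | rfl | h1
  · exact minor_mul_xyProd_of_lt x y hrel d f h r s h1 hs
      fun i h2 h3 => hpos i (by omega) (by omega)
  · ring
  · have := minor_mul_xyProd_of_lt x y hrel d f h s r h1 hr
      fun i h2 h3 => hpos i (by omega) (by omega)
    linear_combination -this

/-- Monomials in the entries of such a chain depend only on their column degrees and their total
degree in the first row, provided the column degrees are antitone. -/
lemma xyProd_eq_of_sum_eq {R : Type*} [CommRing R] (x y : ℕ → R)
    (hrel : ∀ i, x i * y (i + 1) = y i * x (i + 1)) (d : ℕ) (f h f' h' : ℕ → ℕ)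
    (hc : ∀ i < d, f i + h i = f' i + h' i)
    (hanti : ∀ i j, i ≤ j → j < d → f j + h j ≤ f i + h i)
    (hsum : ∑ i ∈ Finset.range d, f i = ∑ i ∈ Finset.range d, f' i) :
    xyProd x y d f h = xyProd x y d f' h' := by
  induction hN : ∑ i ∈ Finset.range d, (f i - f' i) using Nat.strong_induction_on
    generalizing f h with
  | _ N ih =>
  subst hN
  by_cases hle : ∀ i ∈ Finset.range d, f i ≤ f' i
  · have heq := (Finset.sum_eq_sum_iff_of_le hle).1 hsum
    refine Finset.prod_congr rfl fun i hi => ?_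
    have h1 := heq i hi
    have h2 := hc i (Finset.mem_range.1 hi)
    rw [h1, show h i = h' i by omega]
  · push Not at hle
    obtain ⟨r, hr, hrlt⟩ := hle
    obtain ⟨s, hs, hslt⟩ : ∃ s ∈ Finset.range d, f s < f' s := by
      by_contra! hcon
      exact (Finset.sum_lt_sum hcon ⟨r, hr, hrlt⟩).ne' hsum
    rw [Finset.mem_range] at hr hs
    have hrs : r ≠ s := by rintro rfl; omega
    have hcs := hc s hs
    set f₀ := f - Pi.single r 1 with hf₀
    set h₀ := h - Pi.single s 1 with hh₀
    have ef : f = f₀ + Pi.single r 1 := by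
      ext i
      by_cases hi : i = r
      · subst hi; simp [hf₀]; omega
      · simp [hf₀, hi]
    have eh : h = h₀ + Pi.single s 1 := by
      ext i
      by_cases hi : i = s
      · subst hi; simp [hh₀]; omega
      · simp [hh₀, hi]
    have hmove : xyProd x y d f h = xyProd x y d (f₀ + Pi.single s 1) (h₀ + Pi.single r 1) := by
      rw [ef, eh, xyProd_add, xyProd_add, xyProd_single _ _ _ _ _ hr hs,
        xyProd_single _ _ _ _ _ hs hr]
      have := minor_mul_xyProd x y hrel d f₀ h₀ r s hr hs ?_
      · linear_combination this
      · intro i h1 h2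
        have hir : i ≠ r := by omega
        have his : i ≠ s := by omega
        have e1 : f₀ i = f i := by simp [hf₀, hir]
        have e2 : h₀ i = h i := by simp [hh₀, his]
        rw [e1, e2]
        rcases lt_or_gt_of_ne hrs with h3 | h3
        · have := hanti i s (by omega) hs; omega
        · have := hanti i r (by omega) hr; omega
    have hcol : ∀ i, (f₀ + Pi.single s 1 : ℕ → ℕ) i + (h₀ + Pi.single r 1 : ℕ → ℕ) i = f i + h i := by
      intro i
      rw [ef, eh]
      simp only [Pi.add_apply]
      ring
    have hfr : f r = f₀ r + 1 := by rw [ef]; simp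
    rw [hmove]
    refine ih _ ?_ _ _ ?_ ?_ ?_ rfl
    · refine Finset.sum_lt_sum (fun i _ => ?_) ⟨r, Finset.mem_range.2 hr, ?_⟩
      · by_cases his : i = s
        · subst his; simp [hf₀, hrs.symm]; omega
        · simp [his, hf₀]; omega
      · simp [hrs]; omega
    · intro i hi; rw [hcol, hc i hi]
    · intro i j hij hj; rw [hcol, hcol]; exact hanti i j hij hj
    · rw [← hsum, ef]
      simp only [Pi.add_apply, Finset.sum_add_distrib]
      simp [hr, hs]

noncomputable section

variable (k : Type) [Field k] (d : ℕ)

/-- The class of `x_i`, extended by zero. -/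
def xq (i : ℕ) : Sd k d ⧸ KK k d :=
  if h : i < d then Ideal.Quotient.mk (KK k d) (xv k d ⟨i, h⟩) else 0

/-- The class of `y_i`, extended by zero. -/
def yq (i : ℕ) : Sd k d ⧸ KK k d :=
  if h : i < d then Ideal.Quotient.mk (KK k d) (yv k d ⟨i, h⟩) else 0

/-- The class of `z_i`, extended by zero. -/
def zq (i : ℕ) : Sd k d ⧸ KK k d :=
  if h : i < d then Ideal.Quotient.mk (KK k d) (zv k d ⟨i, h⟩) else 0

lemma xq_mul_yq (i : ℕ) : xq k d i * yq k d (i + 1) = yq k d i * xq k d (i + 1) := by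
  by_cases h : i + 1 < d
  · have h' : i < d := by omega
    simp only [xq, yq, h, h', dif_pos, ← map_mul]
    exact Ideal.Quotient.eq.2 (Ideal.subset_span ⟨i, h, Or.inl rfl⟩)
  · simp [xq, yq, h]

lemma zq_mul_xq (i : ℕ) : zq k d i * xq k d (i + 1) = 0 := by
  by_cases h : i + 1 < d
  · have h' : i < d := by omega
    simp only [xq, zq, h, h', dif_pos, ← map_mul]
    exact Ideal.Quotient.eq_zero_iff_mem.2 (Ideal.subset_span ⟨i, h, Or.inr (Or.inl rfl)⟩)
  · simp [xq, h]

lemma zq_mul_yq (i : ℕ) : zq k d i * yq k d (i + 1) = 0 := by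
  by_cases h : i + 1 < d
  · have h' : i < d := by omega
    simp only [yq, zq, h, h', dif_pos, ← map_mul]
    exact Ideal.Quotient.eq_zero_iff_mem.2 (Ideal.subset_span ⟨i, h, Or.inr (Or.inr rfl)⟩)
  · simp [yq, h]

lemma mm_eq_prod (i j : ℕ) : mm k d i j = ∏ t ∈ Finset.range d,
    if t < i then xq k d t else if t < i + j then yq k d t else zq k d t := by
  rw [mm, map_prod, ← Fin.prod_univ_eq_prod_range
    (fun t => if t < i then xq k d t else if t < i + j then yq k d t else zq k d t)]
  refine Finset.prod_congr rfl fun t _ => ?_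
  simp only [xq, yq, zq, t.isLt, dif_pos, Fin.eta]
  split_ifs <;> rfl

/-- The class of the monomial `∏ x_i^{f_i} y_i^{h_i} z_i^{e_i}`. -/
def monoq (f h e : ℕ → ℕ) : Sd k d ⧸ KK k d :=
  xyProd (xq k d) (yq k d) d f h * ∏ i ∈ Finset.range d, zq k d i ^ e i

lemma monoq_add (f h e f' h' e' : ℕ → ℕ) :
    monoq k d (f + f') (h + h') (e + e') = monoq k d f h e * monoq k d f' h' e' := by
  simp only [monoq, xyProd_add, Pi.add_apply, pow_add, Finset.prod_mul_distrib]
  ring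

/-- The exponents of monomials surviving modulo `J(d, d - n)`, with antitone column degrees
in `x, y`. -/
structure IsAdmissible (n : ℕ) (f h e : ℕ → ℕ) : Prop where
  anti : ∀ i j, i ≤ j → j < d → f j + h j ≤ f i + h i
  xy_zero : ∀ i, n < i → f i + h i = 0
  z_zero : ∀ i, i < n → e i = 0

variable {k d} in
lemma IsAdmissible.add {n : ℕ} {f h e f' h' e' : ℕ → ℕ} (H : IsAdmissible d n f h e)
    (H' : IsAdmissible d n f' h' e') : IsAdmissible d n (f + f') (h + h') (e + e') where
  anti i j hij hj := by
    have := H.anti i j hij hj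
    have := H'.anti i j hij hj
    simp only [Pi.add_apply]; omega
  xy_zero i hi := by
    have := H.xy_zero i hi
    have := H'.xy_zero i hi
    simp only [Pi.add_apply]; omega
  z_zero i hi := by simp [H.z_zero i hi, H'.z_zero i hi]

lemma mm_eq_monoq (i j : ℕ) : mm k d i j = monoq k d (fun t => if t < i then 1 else 0)
    (fun t => if i ≤ t ∧ t < i + j then 1 else 0) (fun t => if i + j ≤ t then 1 else 0) := by
  rw [mm_eq_prod, monoq, xyProd, ← Finset.prod_mul_distrib]
  refine Finset.prod_congr rfl fun t _ => ?_
  rcases lt_or_ge t i with h1 | h1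
  · simp [h1, h1.not_ge, show ¬ (i + j ≤ t) by omega]
  · rcases lt_or_ge t (i + j) with h2 | h2
    · simp [h1, h1.not_gt, h2, h2.not_ge]
    · simp [h1, h1.not_gt, h2, h2.not_gt]

/-- The exponent of the image of a monomial under `toDomain`. -/
def imageExp (f h e : ℕ → ℕ) : Option (ℕ × Fin 2) →₀ ℕ :=
  ∑ i ∈ Finset.range d, (Finsupp.single none (f i) + Finsupp.single (some (i, 0)) (f i + h i) +
    Finsupp.single (some (i, 1)) (e i))

lemma imageExp_none (f h e : ℕ → ℕ) :
    imageExp d f h e none = ∑ i ∈ Finset.range d, f i := by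
  simp [imageExp, Finsupp.finsetSum_apply]

lemma imageExp_some_zero (f h e : ℕ → ℕ) (i : ℕ) (hi : i < d) :
    imageExp d f h e (some (i, 0)) = f i + h i := by
  simp [imageExp, Finsupp.single_apply, Finset.sum_add_distrib, hi]

lemma imageExp_some_one (f h e : ℕ → ℕ) (i : ℕ) (hi : i < d) :
    imageExp d f h e (some (i, 1)) = e i := by
  simp [imageExp, Finsupp.finsetSum_apply, Finsupp.single_apply, hi]

lemma monoq_eq_of_imageExp_eq {n : ℕ} {f h e f' h' e' : ℕ → ℕ} (H : IsAdmissible d n f h e)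
    (heq : imageExp d f h e = imageExp d f' h' e') :
    monoq k d f h e = monoq k d f' h' e' := by
  unfold monoq
  congr 1
  · refine xyProd_eq_of_sum_eq _ _ (xq_mul_yq k d) d _ _ _ _ (fun i hi => ?_) H.anti ?_
    · rw [← imageExp_some_zero d f h e i hi, heq, imageExp_some_zero d _ _ _ i hi]
    · rw [← imageExp_none d f h e, heq, imageExp_none]
  · refine Finset.prod_congr rfl fun i hi => ?_
    rw [Finset.mem_range] at hi
    rw [← imageExp_some_one d f h e i hi, heq, imageExp_some_one d _ _ _ i hi]

/-- The values of the variables under `toDomain`. -/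
def toDomainVal (n : ℕ) (p : Fin d × Fin 3) : MvPolynomial (Option (ℕ × Fin 2)) k :=
  if p.2 = 0 then (if n < (p.1 : ℕ) then 0 else X none * X (some ((p.1 : ℕ), 0)))
  else if p.2 = 1 then (if n < (p.1 : ℕ) then 0 else X (some ((p.1 : ℕ), 0)))
  else (if (p.1 : ℕ) < n then 0 else X (some ((p.1 : ℕ), 1)))

/-- The homomorphism from `S(d)/K(d)` to a polynomial ring cutting out the component where
`z_i = 0` for `i < n` and `x_i = y_i = 0` for `i > n`. -/
def toDomain (n : ℕ) : (Sd k d ⧸ KK k d) →ₐ[k] MvPolynomial (Option (ℕ × Fin 2)) k :=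
  Ideal.Quotient.liftₐ (KK k d) (aeval (toDomainVal k d n)) (by
    intro a ha
    rw [← RingHom.mem_ker]
    revert a
    change KK k d ≤ _
    rw [KK, Ideal.span_le]
    rintro p ⟨i, hi, rfl | rfl | rfl⟩ <;>
    · simp only [SetLike.mem_coe, RingHom.mem_ker, map_sub, map_mul, xv, yv, zv, aeval_X,
        toDomainVal]
      by_cases h1 : n < i + 1
      · simp [h1]
      · simp [h1, show i < n by omega, show ¬ (n < i) by omega]
        try ring)

lemma toDomain_mk (n : ℕ) (p : Sd k d) :
    toDomain k d n (Ideal.Quotient.mk (KK k d) p) = aeval (toDomainVal k d n) p := rfl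

lemma toDomain_xq (n i : ℕ) (hi : i < d) : toDomain k d n (xq k d i) =
    if n < i then 0 else X none * X (some (i, 0)) := by
  simp [xq, hi, toDomain_mk, xv, toDomainVal]

lemma toDomain_yq (n i : ℕ) (hi : i < d) : toDomain k d n (yq k d i) =
    if n < i then 0 else X (some (i, 0)) := by
  simp [yq, hi, toDomain_mk, yv, toDomainVal]

lemma toDomain_zq (n i : ℕ) (hi : i < d) : toDomain k d n (zq k d i) =
    if i < n then 0 else X (some (i, 1)) := by
  simp [zq, hi, toDomain_mk, zv, toDomainVal]

lemma toDomain_monoq {n : ℕ} {f h e : ℕ → ℕ} (H : IsAdmissible d n f h e) :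
    toDomain k d n (monoq k d f h e) = monomial (imageExp d f h e) 1 := by
  rw [monoq, xyProd, ← Finset.prod_mul_distrib, map_prod, imageExp, monomial_sum_one]
  refine Finset.prod_congr rfl fun i hi => ?_
  rw [Finset.mem_range] at hi
  have h1 := H.xy_zero i
  have h2 := H.z_zero i
  rw [map_mul, map_mul, map_pow, map_pow, map_pow, toDomain_xq k d n i hi,
    toDomain_yq k d n i hi, toDomain_zq k d n i hi]
  have e1 : (monomial (Finsupp.single none (f i) + Finsupp.single (some (i, 0)) (f i + h i) +
      Finsupp.single (some (i, 1)) (e i)) 1 : MvPolynomial (Option (ℕ × Fin 2)) k) =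
      X none ^ f i * X (some (i, 0)) ^ (f i + h i) * X (some (i, 1)) ^ e i := by
    simp only [X_pow_eq_monomial, monomial_mul, mul_one]
  rw [e1]
  have e2 : (if i < n then 0 else X (some (i, 1)) : MvPolynomial (Option (ℕ × Fin 2)) k) ^ e i =
      X (some (i, 1)) ^ e i := by
    split_ifs with h3
    · simp [h2 h3]
    · rfl
  rw [e2]
  by_cases h3 : n < i
  · have := h1 h3
    simp [show f i = 0 by omega, show h i = 0 by omega]
  · simp only [h3, if_false]
    ring

lemma mem_Jdl_of_xq {l i : ℕ} (hl : 2 ≤ l) (hi : d - l + 1 ≤ i) : xq k d i ∈ Jdl k d l := by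
  rw [xq]
  split_ifs with h
  · rw [Jdl, if_pos hl]
    exact Ideal.subset_span ⟨⟨i, h⟩, hi, Or.inl rfl⟩
  · exact zero_mem _

lemma mem_Jdl_of_yq {l i : ℕ} (hl : 2 ≤ l) (hi : d - l + 1 ≤ i) : yq k d i ∈ Jdl k d l := by
  rw [yq]
  split_ifs with h
  · rw [Jdl, if_pos hl]
    exact Ideal.subset_span ⟨⟨i, h⟩, hi, Or.inr rfl⟩
  · exact zero_mem _

/-- To bound `J(d,l)` above it suffices to treat the generators. -/
lemma Jdl_le {l : ℕ} (I : Ideal (Sd k d ⧸ KK k d))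
    (hx : ∀ i, i < d → d - l + 1 ≤ i → xq k d i ∈ I)
    (hy : ∀ i, i < d → d - l + 1 ≤ i → yq k d i ∈ I) : Jdl k d l ≤ I := by
  rw [Jdl]
  split_ifs with hl
  · rw [Ideal.span_le]
    rintro q ⟨i, hi, rfl | rfl⟩
    · have := hx i i.isLt hi
      rwa [xq, dif_pos i.isLt] at this
    · have := hy i i.isLt hi
      rwa [yq, dif_pos i.isLt] at this
  · exact bot_le

lemma toDomain_eq_zero_of_mem_Jdl {l : ℕ} {a : Sd k d ⧸ KK k d} (ha : a ∈ Jdl k d l) :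
    toDomain k d (d - l) a = 0 := by
  have : Jdl k d l ≤ RingHom.ker (toDomain k d (d - l)) := by
    refine Jdl_le k d _ (fun i h hi => ?_) (fun i h hi => ?_)
    · rw [RingHom.mem_ker, toDomain_xq k d _ i h, if_pos (by omega)]
    · rw [RingHom.mem_ker, toDomain_yq k d _ i h, if_pos (by omega)]
  exact this ha

/-- A monomial divisible by `z_{d-l}, …, z_{d-1}` is killed by `J(d,l)`. -/
lemma mul_mm_eq_zero_of_mem_Jdl {l i j : ℕ} (hij : i + j = d - l) {a : Sd k d ⧸ KK k d}
    (ha : a ∈ Jdl k d l) : a * mm k d i j = 0 := by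
  have hz : ∀ t, d - l ≤ t → t < d → zq k d t ∣ mm k d i j := by
    intro t ht htd
    rw [mm_eq_prod]
    have := Finset.dvd_prod_of_mem (fun t => if t < i then xq k d t else
      if t < i + j then yq k d t else zq k d t) (Finset.mem_range.2 htd)
    simpa [show ¬ t < i by omega, show ¬ t < i + j by omega] using this
  have : Jdl k d l ≤ Submodule.annihilator (Ideal.span {mm k d i j}) := by
    refine Jdl_le k d _ (fun t h ht => ?_) (fun t h ht => ?_) <;>
    · rw [Submodule.mem_annihilator_span_singleton, smul_eq_mul]
      obtain ⟨u, rfl⟩ : ∃ u, t = u + 1 := ⟨t - 1, by omega⟩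
      obtain ⟨c, hc⟩ := hz u (by omega) (by omega)
      first
      | rw [hc, ← mul_assoc, mul_comm (xq k d _), zq_mul_xq, zero_mul]
      | rw [hc, ← mul_assoc, mul_comm (yq k d _), zq_mul_yq, zero_mul]
  have := this ha
  rwa [Submodule.mem_annihilator_span_singleton, smul_eq_mul] at this

lemma isAdmissible_mm {n i j : ℕ} (h1 : n ≤ i + j) (h2 : i + j ≤ n + 1) :
    IsAdmissible d n (fun t => if t < i then 1 else 0)
      (fun t => if i ≤ t ∧ t < i + j then 1 else 0) (fun t => if i + j ≤ t then 1 else 0) where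
  anti a b hab _ := by split_ifs <;> omega
  xy_zero a ha := by split_ifs <;> omega
  z_zero a ha := by split_ifs <;> omega

lemma toDomain_mm_ne_zero {n i j : ℕ} (hij : i + j = n) :
    toDomain k d n (mm k d i j) ≠ 0 := by
  rw [mm_eq_monoq, toDomain_monoq k d (isAdmissible_mm d (by omega) (by omega))]
  simp

lemma mem_closure_cases {l : ℕ} {g : Sd k d ⧸ KK k d} (hl : l ≤ d)
    (hg : g ∈ Submonoid.closure
      {q | ∃ j : ℕ, j ≤ l ∧ ∃ i : ℕ, i ≤ d - j ∧ q = mm k d i (d - i - j)}) :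
    g ∈ Jdl k d l ∨ ∃ f h e, IsAdmissible d (d - l) f h e ∧ g = monoq k d f h e := by
  induction hg using Submonoid.closure_induction with
  | mem g hg =>
    obtain ⟨j, hj, i, hi, rfl⟩ := hg
    by_cases hs : l ≤ j + 1
    · right
      rw [mm_eq_monoq]
      exact ⟨_, _, _, isAdmissible_mm d (by omega) (by omega), rfl⟩
    · left
      have hd : d - l + 1 < d := by omega
      rw [mm_eq_prod]
      refine Ideal.mem_of_dvd _ (Finset.dvd_prod_of_mem _ (Finset.mem_range.2 hd)) ?_
      split_ifs
      · exact mem_Jdl_of_xq k d (by omega) le_rfl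
      · exact mem_Jdl_of_yq k d (by omega) le_rfl
      · omega
  | one =>
    right
    refine ⟨0, 0, 0, ⟨by simp, by simp, by simp⟩, by simp [monoq, xyProd]⟩
  | mul a b _ _ ha hb =>
    rcases ha with ha | ⟨f, h, e, H, rfl⟩
    · exact Or.inl (Ideal.mul_mem_right _ _ ha)
    rcases hb with hb | ⟨f', h', e', H', rfl⟩
    · exact Or.inl (Ideal.mul_mem_left _ _ hb)
    exact Or.inr ⟨_, _, _, H.add H', (monoq_add k d _ _ _ _ _ _).symm⟩

open Classical in
/-- A linear section of `toDomain` on the span of the admissible monomials. -/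
def domainSection (n : ℕ) :
    MvPolynomial (Option (ℕ × Fin 2)) k →ₗ[k] (Sd k d ⧸ KK k d) :=
  (basisMonomials (Option (ℕ × Fin 2)) k).constr k fun D =>
    if H : ∃ p : (ℕ → ℕ) × (ℕ → ℕ) × (ℕ → ℕ),
        IsAdmissible d n p.1 p.2.1 p.2.2 ∧ imageExp d p.1 p.2.1 p.2.2 = D then
      monoq k d H.choose.1 H.choose.2.1 H.choose.2.2
    else 0

lemma domainSection_toDomain_monoq {n : ℕ} {f h e : ℕ → ℕ} (H : IsAdmissible d n f h e) :
    domainSection k d n (toDomain k d n (monoq k d f h e)) = monoq k d f h e := by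
  have hex : ∃ p : (ℕ → ℕ) × (ℕ → ℕ) × (ℕ → ℕ), IsAdmissible d n p.1 p.2.1 p.2.2 ∧
      imageExp d p.1 p.2.1 p.2.2 = imageExp d f h e := ⟨(f, h, e), H, rfl⟩
  have hb : (monomial (imageExp d f h e) 1 : MvPolynomial (Option (ℕ × Fin 2)) k) =
      basisMonomials _ k (imageExp d f h e) := by rw [coe_basisMonomials]
  rw [toDomain_monoq k d H, domainSection, hb, Module.Basis.constr_basis, dif_pos hex]
  exact monoq_eq_of_imageExp_eq k d hex.choose_spec.1 hex.choose_spec.2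

lemma mem_Jdl_of_toDomain_eq_zero {l : ℕ} (hl : l ≤ d) {a : Sd k d ⧸ KK k d}
    (ha : a ∈ Rdl k d l) (h0 : toDomain k d (d - l) a = 0) : a ∈ Jdl k d l := by
  have key : domainSection k d (d - l) (toDomain k d (d - l) a) - a ∈ Jdl k d l := by
    clear h0
    rw [Rdl, ← Subalgebra.mem_toSubmodule, Algebra.adjoin_eq_span] at ha
    induction ha using Submodule.span_induction with
    | mem g hg =>
      rcases mem_closure_cases k d hl hg with hg | ⟨f, h, e, H, rfl⟩
      · rw [toDomain_eq_zero_of_mem_Jdl k d hg, map_zero, zero_sub]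
        exact neg_mem hg
      · rw [domainSection_toDomain_monoq k d H, sub_self]
        exact zero_mem _
    | zero => simp
    | add a b _ _ ha hb =>
      rw [map_add, map_add, add_sub_add_comm]
      exact add_mem ha hb
    | smul c a _ ha =>
      rw [map_smul, map_smul, ← smul_sub]
      exact Submodule.smul_of_tower_mem _ c ha
  rw [h0, map_zero, zero_sub] at key
  exact neg_mem_iff.1 key

lemma mul_mm_eq_zero_iff {l i j : ℕ} (hl : l ≤ d) (hij : i + j = d - l)
    {a : Sd k d ⧸ KK k d} (ha : a ∈ Rdl k d l) :
    a * mm k d i j = 0 ↔ a ∈ Jdl k d l := by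
  refine ⟨fun h => mem_Jdl_of_toDomain_eq_zero k d hl ha ?_, mul_mm_eq_zero_of_mem_Jdl k d hij⟩
  have := congrArg (toDomain k d (d - l)) h
  rw [map_mul, map_zero] at this
  exact (mul_eq_zero.1 this).resolve_right (toDomain_mm_ne_zero k d hij)

end

/-- Statement 14: for `0 ≤ l ≤ d`, the annihilator of `m_{0,d−l,l}` in `R(d,l)`
equals the annihilator of `m_{d−l,0,l}` in `R(d,l)`, and both equal
`J(d,l) ∩ R(d,l)`. -/
theorem statement_14 (k : Type) [Field k] (d : ℕ) (hd : 2 ≤ d) (l : ℕ) (hl : l ≤ d) :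
    ∀ a ∈ Rdl k d l,
      (a * mm k d 0 (d - l) = 0 ↔ a ∈ Jdl k d l) ∧
      (a * mm k d (d - l) 0 = 0 ↔ a ∈ Jdl k d l) := by
  intro a ha
  exact ⟨mul_mm_eq_zero_iff k d hl (by omega) ha, mul_mm_eq_zero_iff k d hl (by omega) ha⟩
end

section
/- Let k be a field, d ≥ 2, and adopt the notation S(d), K(d), m_{i,j,l}, R(d,l) for the algebra A = k⟨x,y,z⟩/⟨xy−yx, zx, zy⟩: S(d) = k[x_i,y_i,z_i : 0 ≤ i ≤ d−1], K(d) = (x_i y_{i+1} − y_i x_{i+1}, z_i x_{i+1}, z_i y_{i+1} : 0 ≤ i ≤ d−2), m_{i,j,l} is the class of x_0⋯x_{i−1} y_i⋯y_{i+j−1} z_{i+j}⋯z_{d−1}, and R(d,l) is the subalgebra of S(d)/K(d) generated by {m_{i,d−i−j,j} : 0 ≤ j ≤ l}. For 0 ≤ l ≤ d set u_{d,l} = Σ_{i=0}^{l} m_{d−i,0,i} and v_{d,l} = Σ_{j=0}^{l} m_{0,d−j,j}. Then for every 0 ≤ l ≤ d, the elements u_{d,l} and v_{d,l} are each non-zero-divisors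 (regular elements) in the ring R(d,l). -/
open MvPolynomial

/-- The class in `S(d)/K(d)` of the monomial with exponent vector `α`. -/
noncomputable def monoClass (k : Type) [Field k] (d : ℕ) (α : Fin d × Fin 3 →₀ ℕ) :
    Sd k d ⧸ KK k d :=
  Ideal.Quotient.mk (KK k d) (monomial α 1)

section Straightening

variable {k : Type} [Field k] {d : ℕ}

lemma monoClass_add (α β : Fin d × Fin 3 →₀ ℕ) :
    monoClass k d (α + β) = monoClass k d α * monoClass k d β := by
  simp [monoClass, ← map_mul, monomial_mul]

lemma monoClass_single (p : Fin d × Fin 3) :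
    monoClass k d (Finsupp.single p 1) = Ideal.Quotient.mk (KK k d) (X p) := rfl

lemma monoClass_comm_succ {i j : Fin d} (hij : (j : ℕ) = i + 1) :
    monoClass k d (Finsupp.single (i, 0) 1) * monoClass k d (Finsupp.single (j, 1) 1) =
      monoClass k d (Finsupp.single (i, 1) 1) * monoClass k d (Finsupp.single (j, 0) 1) := by
  obtain ⟨i, hi⟩ := i
  obtain ⟨j, hj⟩ := j
  obtain rfl : j = i + 1 := hij
  simp only [monoClass_single, ← map_mul]
  exact Ideal.Quotient.eq.2 (Ideal.subset_span ⟨i, hj, Or.inl rfl⟩)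

lemma monoClass_z_mul_succ {i j : Fin d} (hij : (j : ℕ) = i + 1) {c : Fin 3} (hc : c ≠ 2) :
    monoClass k d (Finsupp.single (i, 2) 1) * monoClass k d (Finsupp.single (j, c) 1) = 0 := by
  obtain ⟨i, hi⟩ := i
  obtain ⟨j, hj⟩ := j
  obtain rfl : j = i + 1 := hij
  simp only [monoClass_single, ← map_mul]
  refine Ideal.Quotient.eq_zero_iff_mem.2 (Ideal.subset_span ⟨i, hj, ?_⟩)
  fin_cases c
  · exact Or.inr (Or.inl rfl)
  · exact Or.inr (Or.inr rfl)
  · exact absurd rfl hc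

lemma exists_eq_add_single {σ : Type*} {α : σ →₀ ℕ} {p : σ} (hp : 0 < α p) :
    ∃ γ : σ →₀ ℕ, α = γ + Finsupp.single p 1 :=
  ⟨α - Finsupp.single p 1, (tsub_add_cancel_of_le (Finsupp.single_le_iff.2 hp)).symm⟩

lemma monoClass_mul_comm_of_lt (n : ℕ) : ∀ (i j : Fin d), (j : ℕ) = i + n + 1 →
    ∀ γ : Fin d × Fin 3 →₀ ℕ, (∀ t, i < t → t < j → 0 < γ (t, 0) + γ (t, 1)) →
    monoClass k d γ * monoClass k d (Finsupp.single (i, 0) 1) *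
        monoClass k d (Finsupp.single (j, 1) 1) =
      monoClass k d γ * monoClass k d (Finsupp.single (i, 1) 1) *
        monoClass k d (Finsupp.single (j, 0) 1) := by
  induction n with
  | zero =>
    intro i j hij γ _
    have h := monoClass_comm_succ (k := k) hij
    linear_combination monoClass k d γ * h
  | succ n ih =>
    intro i j hij γ hγ
    obtain ⟨t, ht⟩ : ∃ t : Fin d, (t : ℕ) = i + n + 1 := ⟨⟨i + n + 1, by omega⟩, rfl⟩
    have adj := monoClass_comm_succ (k := k) (i := t) (j := j) (by omega)
    have key : ∀ γ' : Fin d × Fin 3 →₀ ℕ, ∀ c, γ = γ' + Finsupp.single (t, c) 1 →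
        ∀ r, i < r → r < t → 0 < γ' (r, 0) + γ' (r, 1) := by
      rintro γ' c rfl r hir hrt
      simpa [Finsupp.single_apply, hrt.ne'] using hγ r hir (by omega)
    rcases Nat.add_pos_iff_pos_or_pos.1 (hγ t (by omega) (by omega)) with h | h
    · obtain ⟨γ', hγ'⟩ := exists_eq_add_single h
      have := ih i t ht γ' (key γ' 0 hγ')
      rw [hγ', monoClass_add]
      linear_combination (monoClass k d γ' * monoClass k d (Finsupp.single (i, 0) 1)) * adj +
        monoClass k d (Finsupp.single (j, 0) 1) * this
    · obtain ⟨γ', hγ'⟩ := exists_eq_add_single h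
      have := ih i t ht γ' (key γ' 1 hγ')
      rw [hγ', monoClass_add]
      linear_combination (monoClass k d γ' * monoClass k d (Finsupp.single (i, 1) 1)) * adj +
        monoClass k d (Finsupp.single (j, 1) 1) * this

/-- An `x` and a `y` in distinct positions of a monomial can be exchanged, provided every position
strictly between them is occupied by an `x` or a `y`. -/
lemma monoClass_exchange {i j : Fin d} (hij : i ≠ j) (γ : Fin d × Fin 3 →₀ ℕ)
    (hγ : ∀ t, (i < t ∧ t < j ∨ j < t ∧ t < i) → 0 < γ (t, 0) + γ (t, 1)) :
    monoClass k d (γ + Finsupp.single (i, 0) 1 + Finsupp.single (j, 1) 1) =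
      monoClass k d (γ + Finsupp.single (i, 1) 1 + Finsupp.single (j, 0) 1) := by
  simp only [monoClass_add]
  rcases lt_or_gt_of_ne hij with h | h
  · exact monoClass_mul_comm_of_lt (j - i - 1) i j (by omega) γ
      fun t h1 h2 => hγ t (Or.inl ⟨h1, h2⟩)
  · have := monoClass_mul_comm_of_lt (k := k) (i - j - 1) j i (by omega) γ
      fun t h1 h2 => hγ t (Or.inr ⟨h1, h2⟩)
    linear_combination -this

lemma monoClass_eq_of_sum_eq (n : ℕ) : ∀ α β : Fin d × Fin 3 →₀ ℕ,
    ∑ t, (α (t, 0) - β (t, 0)) = n →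
    (∀ t, α (t, 0) + α (t, 1) = β (t, 0) + β (t, 1)) → (∀ t, α (t, 2) = β (t, 2)) →
    ∑ t, α (t, 0) = ∑ t, β (t, 0) →
    (∀ t j, t < j → 0 < β (j, 0) + β (j, 1) → 0 < β (t, 0) + β (t, 1)) →
    monoClass k d α = monoClass k d β := by
  induction n using Nat.strong_induction_on with
  | _ n ih =>
    intro α β hn hdeg hz hsum hfull
    by_cases hle : ∀ t, α (t, 0) ≤ β (t, 0)
    · have h0 := (Finset.sum_eq_sum_iff_of_le fun t _ => hle t).1 hsum
      congr 1
      ext ⟨t, c⟩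
      have := h0 t (Finset.mem_univ t)
      have := hdeg t
      fin_cases c
      · simpa
      · change α (t, 1) = β (t, 1)
        omega
      · exact hz t
    · push Not at hle
      obtain ⟨i, hi⟩ := hle
      obtain ⟨j, hj⟩ : ∃ j, α (j, 0) < β (j, 0) := by
        by_contra! hge
        exact (Finset.sum_lt_sum (fun t _ => hge t) ⟨i, Finset.mem_univ i, hi⟩).ne' hsum
      have hij : i ≠ j := by
        rintro rfl
        omega
      obtain ⟨γ₁, h₁⟩ := exists_eq_add_single (α := α) (p := (j, 1)) (by have := hdeg j; omega)
      obtain ⟨γ, h₂⟩ := exists_eq_add_single (α := γ₁) (p := (i, 0)) (by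
        have : α (i, 0) = γ₁ (i, 0) := by simp [h₁]
        omega)
      subst h₂
      have e0 : ∀ t, α (t, 0) = γ (t, 0) + if i = t then 1 else 0 := by
        intro t; simp [h₁, Finsupp.single_apply]
      have e1 : ∀ t, α (t, 1) = γ (t, 1) + if j = t then 1 else 0 := by
        intro t; simp [h₁, Finsupp.single_apply]
      have e2 : ∀ t, α (t, 2) = γ (t, 2) := by
        intro t; simp [h₁]
      set α' := γ + Finsupp.single (i, 1) 1 + Finsupp.single (j, 0) 1 with hα'
      have f0 : ∀ t, α' (t, 0) = γ (t, 0) + if j = t then 1 else 0 := by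
        intro t; simp [hα', Finsupp.single_apply]
      have f1 : ∀ t, α' (t, 1) = γ (t, 1) + if i = t then 1 else 0 := by
        intro t; simp [hα', Finsupp.single_apply]
      have f2 : ∀ t, α' (t, 2) = γ (t, 2) := by
        intro t; simp [hα']
      have hstep : monoClass k d α = monoClass k d α' := by
        rw [h₁, hα']
        refine monoClass_exchange hij γ fun t ht => ?_
        have hpos : 0 < β (t, 0) + β (t, 1) := by
          rcases ht with ht | ht
          · exact hfull t j ht.2 (by omega)
          · exact hfull t i ht.2 (by have := hdeg i; omega)
        have hit : i ≠ t := by omega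
        have hjt : j ≠ t := by omega
        have := hdeg t
        have := e0 t
        have := e1 t
        simp only [hit, hjt, if_false] at *
        omega
      rw [hstep]
      refine ih _ ?_ α' β rfl ?_ ?_ ?_ hfull
      · rw [← hn]
        refine Finset.sum_lt_sum (fun t _ => ?_) ⟨i, Finset.mem_univ i, ?_⟩
        · rw [e0, f0]
          split_ifs with h h'
          · omega
          · subst h
            have := e0 j
            simp only [hij, if_false] at this
            omega
          · omega
          · omega
        · have := e0 i
          have := f0 i
          simp only [hij.symm, if_true, if_false] at *
          omega
      · intro t
        have := hdeg t
        have := e0 t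
        have := e1 t
        have := f0 t
        have := f1 t
        omega
      · intro t
        rw [f2, ← e2, hz]
      · rw [← hsum]
        simp only [e0, f0, Finset.sum_add_distrib]
        simp

end Straightening

/-- Variables allowed to be nonzero on the `s`-th component of the truncated point scheme. -/
def Admissible {d : ℕ} (s : Fin d) (p : Fin d × Fin 3) : Prop :=
  if p.2 = 2 then s ≤ p.1 else p.1 ≤ s

/-- The parametrization `x_t ↦ a w_t`, `y_t ↦ w_t`, `z_t ↦ ζ_t` on exponents. -/
noncomputable def paramExp {d : ℕ} (p : Fin d × Fin 3) : Option (Fin d × Bool) →₀ ℕ :=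
  if p.2 = 2 then Finsupp.single (some (p.1, true)) 1
  else (if p.2 = 0 then Finsupp.single none 1 else 0) + Finsupp.single (some (p.1, false)) 1

open Classical in
/-- The restriction to the `s`-th component on polynomials. -/
noncomputable def componentPoly (k : Type) [Field k] {d : ℕ} (s : Fin d) :
    Sd k d →ₐ[k] MvPolynomial (Option (Fin d × Bool)) k :=
  aeval fun p => if Admissible s p then monomial (paramExp p) 1 else 0

lemma componentPoly_mem_KK (k : Type) [Field k] {d : ℕ} (s : Fin d) :
    ∀ a ∈ KK k d, componentPoly k s a = 0 := by
  suffices KK k d ≤ RingHom.ker (componentPoly k s) from fun a ha => this ha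
  refine Ideal.span_le.2 ?_
  rintro p ⟨i, h, rfl | rfl | rfl⟩ <;>
    simp only [SetLike.mem_coe, RingHom.mem_ker, componentPoly, xv, yv, zv, map_sub, map_mul,
      aeval_X, Admissible, paramExp, Fin.le_def]
  · by_cases h1 : i + 1 ≤ s
    · have h2 : i ≤ s := by omega
      simp [h1, h2, monomial_mul, add_assoc, add_left_comm]
    · simp [h1]
  all_goals
    by_cases h1 : i + 1 ≤ s
    · have h2 : ¬ (s : ℕ) ≤ i := by omega
      simp [h2]
    · simp [h1]

/-- The restriction of functions to the `s`-th component of the truncated point scheme. -/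
noncomputable def componentMap (k : Type) [Field k] {d : ℕ} (s : Fin d) :
    Sd k d ⧸ KK k d →ₐ[k] MvPolynomial (Option (Fin d × Bool)) k :=
  Ideal.Quotient.liftₐ (KK k d) (componentPoly k s) (componentPoly_mem_KK k s)

section Components

variable {k : Type} [Field k] {d : ℕ}

lemma componentMap_mk (s : Fin d) (f : Sd k d) :
    componentMap k s (Ideal.Quotient.mk (KK k d) f) = componentPoly k s f := rfl

open Classical in
lemma componentMap_monoClass (s : Fin d) (α : Fin d × Fin 3 →₀ ℕ) :
    componentMap k s (monoClass k d α) =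
      if ∀ p, α p ≠ 0 → Admissible s p then monomial (∑ p, α p • paramExp p) 1 else 0 := by
  rw [monoClass, componentMap_mk, componentPoly, aeval_monomial,
    Finsupp.prod_fintype _ _ (fun _ => pow_zero _)]
  split_ifs with h
  · rw [map_one, one_mul, monomial_sum_one]
    refine Finset.prod_congr rfl fun p _ => ?_
    by_cases hp : α p = 0
    · simp [hp]
    · rw [if_pos (h p hp), monomial_pow, one_pow]
  · push Not at h
    obtain ⟨p, hp, hs⟩ := h
    rw [Finset.prod_eq_zero (Finset.mem_univ p), mul_zero]
    simp [hs, hp]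

lemma sum_paramExp_none (α : Fin d × Fin 3 →₀ ℕ) :
    (∑ p, α p • paramExp p : Option (Fin d × Bool) →₀ ℕ) none = ∑ t, α (t, 0) := by
  simp [Finsupp.finsetSum_apply, Fintype.sum_prod_type, Fin.sum_univ_three, paramExp]

lemma sum_paramExp_false (α : Fin d × Fin 3 →₀ ℕ) (t : Fin d) :
    (∑ p, α p • paramExp p : Option (Fin d × Bool) →₀ ℕ) (some (t, false)) =
      α (t, 0) + α (t, 1) := by
  simp [Fintype.sum_prod_type, Fin.sum_univ_three, paramExp,
    Finsupp.single_apply, Finset.sum_add_distrib]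

lemma sum_paramExp_true (α : Fin d × Fin 3 →₀ ℕ) (t : Fin d) :
    (∑ p, α p • paramExp p : Option (Fin d × Bool) →₀ ℕ) (some (t, true)) = α (t, 2) := by
  simp [Finsupp.finsetSum_apply, Fintype.sum_prod_type, Fin.sum_univ_three, paramExp,
    Finsupp.single_apply]

end Components

/-- Exponent vectors of the same degree in every position, with `z` only in the last `l`
positions. -/
def balancedExps (d l : ℕ) : AddSubmonoid (Fin d × Fin 3 →₀ ℕ) where
  carrier := {α | (∃ N, ∀ t, α (t, 0) + α (t, 1) + α (t, 2) = N) ∧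
    ∀ t : Fin d, (t : ℕ) + l < d → α (t, 2) = 0}
  zero_mem' := ⟨⟨0, by simp⟩, by simp⟩
  add_mem' := by
    rintro α β ⟨⟨N, hN⟩, hα⟩ ⟨⟨N', hN'⟩, hβ⟩
    refine ⟨⟨N + N', fun t => ?_⟩, fun t ht => ?_⟩
    · simp only [Finsupp.add_apply, ← hN t, ← hN' t]
      omega
    · simp [hα t ht, hβ t ht]

section Balanced

variable {k : Type} [Field k] {d l : ℕ}

lemma mm_eq_monoClass (i j : ℕ) : mm k d i j = monoClass k d (∑ t : Fin d,
    Finsupp.single (t, if (t : ℕ) < i then (0 : Fin 3) else if (t : ℕ) < i + j then 1 else 2) 1) := by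
  rw [mm, monoClass, monomial_sum_one]
  congr 1
  refine Finset.prod_congr rfl fun t _ => ?_
  split_ifs <;> rfl

lemma Rdl_le_span :
    Subalgebra.toSubmodule (Rdl k d l) ≤ Submodule.span k (monoClass k d '' balancedExps d l) := by
  rw [Rdl, Algebra.adjoin_eq_span]
  refine Submodule.span_mono ?_
  intro q hq
  induction hq using Submonoid.closure_induction with
  | mem q hq =>
    obtain ⟨j, hj, i, hi, rfl⟩ := hq
    refine ⟨_, ⟨⟨1, fun t => ?_⟩, fun t ht => ?_⟩, (mm_eq_monoClass _ _).symm⟩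
    · simp only [Finsupp.finsetSum_apply, Finsupp.single_apply, Prod.mk.injEq, ite_and,
        Finset.sum_ite_eq', Finset.mem_univ, if_true]
      split_ifs <;> simp_all
    · simp only [Finsupp.finsetSum_apply, Finsupp.single_apply, Prod.mk.injEq, ite_and,
        Finset.sum_ite_eq', Finset.mem_univ, if_true]
      have : (t : ℕ) < i + (d - i - j) := by omega
      split_ifs <;> simp_all
  | one => exact ⟨0, zero_mem _, by simp [monoClass]⟩
  | mul p q _ _ hp hq =>
    obtain ⟨α, hα, rfl⟩ := hp
    obtain ⟨β, hβ, rfl⟩ := hq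
    exact ⟨α + β, add_mem hα hβ, monoClass_add α β⟩

/-- A nonzero balanced monomial survives on a component `s` with `d - 1 - l ≤ s`. -/
lemma exists_admissible (hd : 0 < d) {α : Fin d × Fin 3 →₀ ℕ} (hα : α ∈ balancedExps d l)
    (h0 : monoClass k d α ≠ 0) :
    ∃ s : Fin d, d ≤ s + 1 + l ∧ ∀ p, α p ≠ 0 → Admissible s p := by
  obtain ⟨⟨N, hN⟩, hz⟩ := hα
  have hadj : ∀ i j : Fin d, (j : ℕ) = i + 1 → α (i, 2) ≠ 0 → ∀ c, c ≠ 2 → α (j, c) = 0 := by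
    intro i j hij hi c hc
    by_contra hne
    obtain ⟨γ₁, h₁⟩ := exists_eq_add_single (Nat.pos_of_ne_zero hi)
    obtain ⟨γ, h₂⟩ := exists_eq_add_single (α := γ₁) (p := (j, c)) (by
      have : α (j, c) = γ₁ (j, c) := by simp [h₁, hc.symm]
      omega)
    apply h0
    rw [h₁, h₂, monoClass_add, monoClass_add]
    linear_combination monoClass k d γ * monoClass_z_mul_succ (k := k) hij hc
  have hprop : ∀ n : ℕ, ∀ i j : Fin d, (j : ℕ) = i + n + 1 → α (i, 2) ≠ 0 →
      α (j, 0) = 0 ∧ α (j, 1) = 0 := by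
    intro n
    induction n with
    | zero => exact fun i j hij hi => ⟨hadj i j hij hi 0 (by decide), hadj i j hij hi 1 (by decide)⟩
    | succ n ih =>
      intro i j hij hi
      obtain ⟨t, ht⟩ : ∃ t : Fin d, (t : ℕ) = i + n + 1 := ⟨⟨i + n + 1, by omega⟩, rfl⟩
      have h1 := ih i t ht hi
      by_cases ht2 : α (t, 2) = 0
      · have := hN t
        have := hN j
        omega
      · exact ⟨hadj t j (by omega) ht2 0 (by decide), hadj t j (by omega) ht2 1 (by decide)⟩
  by_cases hex : ∃ n : ℕ, ∃ h : n < d, α (⟨n, h⟩, 2) ≠ 0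
  · classical
    obtain ⟨hlt, hs⟩ := Nat.find_spec hex
    refine ⟨⟨Nat.find hex, hlt⟩, ?_, ?_⟩
    · by_contra hcon
      exact hs (hz _ (by simp only at hcon ⊢; omega))
    · rintro ⟨t, c⟩ hp
      unfold Admissible
      split_ifs with hc
      · obtain rfl : c = 2 := hc
        exact Nat.find_min' hex ⟨t.2, hp⟩
      · by_contra hts
        have hts' : Nat.find hex < (t : ℕ) := by simpa [Fin.lt_def] using hts
        have := hprop (t - Nat.find hex - 1) ⟨_, hlt⟩ t (by simp only; omega) hs
        fin_cases c
        · exact hp this.1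
        · exact hp this.2
        · exact hc rfl
  · push Not at hex
    refine ⟨⟨d - 1, by omega⟩, by simp only; omega, ?_⟩
    rintro ⟨t, c⟩ hp
    unfold Admissible
    split_ifs with hc
    · obtain rfl : c = 2 := hc
      exact absurd (hex t t.2) hp
    · exact Fin.le_def.2 (by simp only; omega)

lemma monoClass_eq_of_sum_paramExp_eq {s : Fin d} {α β : Fin d × Fin 3 →₀ ℕ}
    (hβ : β ∈ balancedExps d l) (hβs : ∀ p, β p ≠ 0 → Admissible s p)
    (h : ∑ p, α p • paramExp p = ∑ p, β p • paramExp p) :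
    monoClass k d α = monoClass k d β := by
  refine monoClass_eq_of_sum_eq _ α β rfl (fun t => ?_) (fun t => ?_) ?_ ?_
  · rw [← sum_paramExp_false, h, sum_paramExp_false]
  · rw [← sum_paramExp_true, h, sum_paramExp_true]
  · rw [← sum_paramExp_none, h, sum_paramExp_none]
  · intro t j htj hj
    obtain ⟨⟨N, hN⟩, -⟩ := hβ
    have hjs : j ≤ s := by
      rcases Nat.add_pos_iff_pos_or_pos.1 hj with h' | h'
      · simpa [Admissible] using hβs _ h'.ne'
      · simpa [Admissible] using hβs _ h'.ne'
    have h2 : β (t, 2) = 0 := by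
      by_contra hne
      have : s ≤ t := by simpa [Admissible] using hβs _ hne
      omega
    have := hN t
    have := hN j
    omega

lemma eq_zero_of_componentMap_eq_zero (hd : 0 < d) {a : Sd k d ⧸ KK k d} (ha : a ∈ Rdl k d l)
    (h : ∀ s : Fin d, d ≤ s + 1 + l → componentMap k s a = 0) : a = 0 := by
  classical
  have ha' : a ∈ Submodule.span k (monoClass k d '' balancedExps d l \ {0}) := by
    rw [Submodule.span_sdiff_singleton_zero]
    exact Rdl_le_span ha
  obtain ⟨c, hc, rfl⟩ := Submodule.mem_span_set.1 ha'
  suffices c = 0 by simp [this]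
  ext v
  by_contra hv
  obtain ⟨⟨β, hβ, rfl⟩, hβ0⟩ := hc (Finsupp.mem_support_iff.2 hv)
  obtain ⟨s, hs, hadm⟩ := exists_admissible hd hβ hβ0
  have hs0 := congrArg (coeff (∑ p, β p • paramExp p)) (h s hs)
  rw [Finsupp.sum, map_sum, coeff_sum, Finset.sum_eq_single (monoClass k d β)] at hs0
  · rw [map_smul, componentMap_monoClass, if_pos hadm] at hs0
    exact hv (by simpa using hs0)
  · intro w hw hne
    obtain ⟨⟨α, hα, rfl⟩, -⟩ := hc hw
    rw [map_smul, componentMap_monoClass]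
    split_ifs
    · rw [coeff_smul, coeff_monomial, if_neg, smul_zero]
      exact fun heq => hne (monoClass_eq_of_sum_paramExp_eq hβ hadm heq)
    · simp
  · intro hnot
    exact absurd (Finsupp.mem_support_iff.2 hv) hnot

end Balanced

/-- Evaluation at the point of the `s`-th component with `ζ_s = 0` and all other parameters `1`. -/
noncomputable def componentEval (k : Type) [Field k] {d : ℕ} (s : Fin d) :
    MvPolynomial (Option (Fin d × Bool)) k →ₐ[k] k :=
  aeval fun p => if p = some (s, true) then 0 else 1

section Evaluation

variable {k : Type} [Field k] {d l : ℕ}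

lemma componentEval_mm (s : Fin d) (i j : ℕ) (hij : i + j ≤ d) :
    componentEval k s (componentMap k s (mm k d i j)) = if i + j = s + 1 then 1 else 0 := by
  classical
  have hX : ∀ p : Fin d × Fin 3, componentEval k s (componentPoly k s (X p)) =
      if p.2 = 2 then (if s < p.1 then 1 else 0) else if p.1 ≤ s then 1 else 0 := by
    rintro ⟨t, c⟩
    rw [componentPoly, aeval_X]
    by_cases hc : c = 2
    · subst hc
      rcases lt_trichotomy s t with h | h | h
      · simp [Admissible, paramExp, componentEval, aeval_monomial, h, h.le, h.ne']
      · simp [Admissible, paramExp, componentEval, aeval_monomial, h]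
      · simp [Admissible, componentEval, h.not_ge, h.not_gt]
    · by_cases hts : t ≤ s
      · by_cases hc0 : c = 0 <;>
          simp [Admissible, paramExp, componentEval, aeval_monomial, hc, hc0, hts]
      · simp [Admissible, hc, hts]
  have hfac : ∀ t : Fin d, componentEval k s (componentPoly k s
      (if (t : ℕ) < i then xv k d t else if (t : ℕ) < i + j then yv k d t else zv k d t)) =
      if (t : ℕ) < i + j ↔ t ≤ s then 1 else 0 := by
    intro t
    by_cases h1 : (t : ℕ) < i
    · have h2 : (t : ℕ) < i + j := by omega
      simp [h1, h2, xv, hX]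
    · by_cases h2 : (t : ℕ) < i + j
      · simp [h1, h2, yv, hX]
      · simp [h1, h2, zv, hX]
  rw [mm, componentMap_mk, map_prod, map_prod, Finset.prod_congr rfl fun t _ => hfac t]
  split_ifs with h
  · refine Finset.prod_eq_one fun t _ => if_pos ?_
    rw [Fin.le_def]
    omega
  · rcases Nat.lt_or_gt_of_ne h with h | h
    · refine Finset.prod_eq_zero (Finset.mem_univ s) (if_neg ?_)
      simp only [le_refl, iff_true]
      omega
    · refine Finset.prod_eq_zero (Finset.mem_univ (⟨s + 1, by omega⟩ : Fin d)) (if_neg ?_)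
      simp only [Fin.le_def]
      omega

lemma sum_ite_sub_eq (s : Fin d) (hs : d ≤ s + 1 + l) (hl : l ≤ d) :
    (∑ i ∈ Finset.range (l + 1), if d - i = (s : ℕ) + 1 then (1 : k) else 0) = 1 := by
  rw [Finset.sum_eq_single_of_mem (d - 1 - (s : ℕ)) (Finset.mem_range.2 (by omega)),
    if_pos (by omega)]
  intro i hi hne
  rw [Finset.mem_range] at hi
  exact if_neg (by omega)

lemma componentEval_uu (s : Fin d) (hs : d ≤ s + 1 + l) (hl : l ≤ d) :
    componentEval k s (componentMap k s (uu k d l)) = 1 := by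
  rw [uu, map_sum, map_sum, ← sum_ite_sub_eq s hs hl]
  refine Finset.sum_congr rfl fun i _ => ?_
  rw [componentEval_mm s _ _ (by omega), add_zero]

lemma componentEval_vv (s : Fin d) (hs : d ≤ s + 1 + l) (hl : l ≤ d) :
    componentEval k s (componentMap k s (vv k d l)) = 1 := by
  rw [vv, map_sum, map_sum, ← sum_ite_sub_eq s hs hl]
  refine Finset.sum_congr rfl fun i _ => ?_
  rw [componentEval_mm s _ _ (by omega), zero_add]

lemma eq_zero_of_mul_eq_zero (hd : 0 < d) {a b : Sd k d ⧸ KK k d} (ha : a ∈ Rdl k d l)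
    (hb : ∀ s : Fin d, d ≤ s + 1 + l → componentEval k s (componentMap k s b) = 1)
    (hab : a * b = 0) : a = 0 := by
  refine eq_zero_of_componentMap_eq_zero hd ha fun s hs => ?_
  have h := congrArg (componentMap k s) hab
  rw [map_mul, map_zero] at h
  refine (mul_eq_zero.1 h).resolve_right fun h0 => ?_
  simpa [h0] using hb s hs

end Evaluation

/-- Statement 15: for every `0 ≤ l ≤ d`, the elements
`u_{d,l} = Σ_{i=0}^{l} m_{d−i,0,i}` and `v_{d,l} = Σ_{j=0}^{l} m_{0,d−j,j}` are
non-zero-divisors (regular elements) in the subring `R(d,l)`. -/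
theorem statement_15 (k : Type) [Field k] (d : ℕ) (hd : 2 ≤ d) (l : ℕ) (hl : l ≤ d) :
    ∀ a ∈ Rdl k d l,
      (a * uu k d l = 0 → a = 0) ∧ (a * vv k d l = 0 → a = 0) := by
  exact fun a ha => ⟨eq_zero_of_mul_eq_zero (by omega) ha fun s hs => componentEval_uu s hs hl,
    eq_zero_of_mul_eq_zero (by omega) ha fun s hs => componentEval_vv s hs hl⟩
end

section
/- Let k be a field and d ≥ 2. With S(d) = k[x_i,y_i,z_i : 0 ≤ i ≤ d−1], K(d) = (x_i y_{i+1} − y_i x_{i+1}, z_i x_{i+1}, z_i y_{i+1} : 0 ≤ i ≤ d−2), m_{i,j,l} the class of x_0⋯x_{i−1} y_i⋯y_{i+j−1} z_{i+j}⋯z_{d−1} in S(d)/K(d), and R(d,1) the k-subalgebra of S(d)/K(d) generated by {m_{i,d−i,0} : 0 ≤ i ≤ d} ∪ {m_{i,d−i−1,1} : 0 ≤ i ≤ d−1}, the pair {u_{d,1}, v_{d,1}} with u_{d,1} = m_{d,0,0} + m_{d−1,0,1} and v_{d,1} = m_{0,d,0} + m_{0,d−1,1} is a regular sequence in R(d,1):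 u_{d,1} is a non-zero-divisor in R(d,1), and v_{d,1} is a non-zero-divisor modulo the ideal generated by u_{d,1}. -/
open MvPolynomial

namespace PathMinors

variable {A : Type*} [CommRing A]

/-- The product `x 0 ⋯ x (i - 1) * y i ⋯ y (n - 1)`. -/
def stair (x y : ℕ → A) (n i : ℕ) : A :=
  (∏ t ∈ Finset.range i, x t) * ∏ t ∈ Finset.Ico i n, y t

/-- The product of `f` with `a` staircase products of length `n`, each scaled by `c`, in which
a total of `i` letters `x` is distributed greedily, the remainder being passed on to `f`. -/
def fill (x y : ℕ → A) (n : ℕ) (c : A) (f : ℕ → A) : ℕ → ℕ → A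
  | 0, i => f i
  | a + 1, i => c * stair x y n (min i n) * fill x y n c f a (i - n)

/-- A letter `x` may be moved between a staircase product and `f`, as long as the argument of
`f` stays at most `C`. -/
def Exchanges (x y : ℕ → A) (f : ℕ → A) (C : ℕ) : Prop :=
  ∀ n i s, i < n → s < C → stair x y n i * f (s + 1) = stair x y n (i + 1) * f s

variable {x y : ℕ → A}

theorem mul_prod_range_succ_of_swap (h : ∀ t, x t * y (t + 1) = y t * x (t + 1)) {i j : ℕ}
    (hij : i ≤ j) :
    y i * ∏ t ∈ Finset.range (j + 1), x t = x i * (∏ t ∈ Finset.range j, x t) * y j := by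
  induction j, hij using Nat.le_induction with
  | base => rw [Finset.prod_range_succ]; ring
  | succ j _ ih =>
    rw [Finset.prod_range_succ, ← mul_assoc, ih, Finset.prod_range_succ]
    linear_combination -(x i * ∏ t ∈ Finset.range j, x t) * h j

theorem stair_mul_stair_succ (h : ∀ t, x t * y (t + 1) = y t * x (t + 1)) {n m i j : ℕ}
    (hi : i < n) (hj : j < m) :
    stair x y n i * stair x y m (j + 1) = stair x y n (i + 1) * stair x y m j := by
  simp only [stair, Finset.prod_eq_prod_Ico_succ_bot hi, Finset.prod_eq_prod_Ico_succ_bot hj]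
  rcases le_total i j with hij | hij
  · have := mul_prod_range_succ_of_swap h hij
    rw [Finset.prod_range_succ x i]
    linear_combination ((∏ t ∈ Finset.range i, x t) * (∏ t ∈ Finset.Ico (i + 1) n, y t) *
      ∏ t ∈ Finset.Ico (j + 1) m, y t) * this
  · have := mul_prod_range_succ_of_swap h hij
    rw [Finset.prod_range_succ x j]
    linear_combination -((∏ t ∈ Finset.range j, x t) * (∏ t ∈ Finset.Ico (i + 1) n, y t) *
      ∏ t ∈ Finset.Ico (j + 1) m, y t) * this

theorem Exchanges.fill (h : ∀ t, x t * y (t + 1) = y t * x (t + 1)) {f : ℕ → A} {C : ℕ}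
    (hf : Exchanges x y f C) (n : ℕ) (c : A) (a : ℕ) :
    Exchanges x y (fill x y n c f a) (n * a + C) := by
  induction a with
  | zero => simpa [PathMinors.fill] using hf
  | succ a ih =>
    intro m i s hi hs
    simp only [PathMinors.fill]
    rcases lt_or_ge s n with hsn | hsn
    · rw [min_eq_left hsn.le, min_eq_left (Nat.succ_le_of_lt hsn), Nat.sub_eq_zero_of_le hsn.le,
        Nat.sub_eq_zero_of_le (Nat.succ_le_of_lt hsn)]
      linear_combination (c * PathMinors.fill x y n c f a 0) * stair_mul_stair_succ h hi hsn
    · rw [min_eq_right hsn, min_eq_right (hsn.trans s.le_succ), Nat.succ_sub hsn]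
      have := ih m i (s - n) hi (by rw [Nat.mul_succ] at hs; omega)
      linear_combination (c * stair x y n n) * this

theorem Exchanges.stair_mul_fill (h : ∀ t, x t * y (t + 1) = y t * x (t + 1)) {f : ℕ → A} {C : ℕ}
    (hf : Exchanges x y f C) {n : ℕ} (c : A) (a : ℕ) {j s : ℕ} (hj : j ≤ n)
    (hs : s ≤ n * a + C) :
    c * stair x y n j * PathMinors.fill x y n c f a s =
      PathMinors.fill x y n c f (a + 1) (s + j) := by
  induction s generalizing j with
  | zero => simp [PathMinors.fill, hj]
  | succ s ih =>
    rcases hj.lt_or_eq with hjn | rfl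
    · rw [mul_assoc, hf.fill h n c a n j s hjn hs, ← mul_assoc, ih hjn (by omega)]
      congr 1; omega
    · simp [PathMinors.fill]

/-- The normal form of a product of `a` staircase products of length `e + 1` and `b` staircase
products of length `e` scaled by `z`, containing `i` letters `x` in total. -/
def normalForm (x y : ℕ → A) (e : ℕ) (z : A) (a b i : ℕ) : A :=
  fill x y (e + 1) 1 (fill x y e z (fun _ => 1) b) a i

theorem exchanges_fill_one (h : ∀ t, x t * y (t + 1) = y t * x (t + 1)) (e : ℕ) (z : A) (b : ℕ) :
    Exchanges x y (fill x y e z (fun _ => 1) b) (e * b) :=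
  Exchanges.fill h (C := 0) (fun _ _ _ _ hs => absurd hs (Nat.not_lt_zero _)) e z b

theorem stair_mul_normalForm (h : ∀ t, x t * y (t + 1) = y t * x (t + 1)) {e : ℕ} (z : A)
    {a b j s : ℕ} (hj : j ≤ e + 1) (hs : s ≤ (e + 1) * a + e * b) :
    stair x y (e + 1) j * normalForm x y e z a b s = normalForm x y e z (a + 1) b (s + j) := by
  simpa [normalForm] using (exchanges_fill_one h e z b).stair_mul_fill h 1 a hj hs

theorem mul_stair_mul_normalForm (h : ∀ t, x t * y (t + 1) = y t * x (t + 1)) {e : ℕ} (z : A)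
    {a b j s : ℕ} (hj : j ≤ e) (hs : s ≤ (e + 1) * a + e * b) :
    z * stair x y e j * normalForm x y e z a b s = normalForm x y e z a (b + 1) (s + j) := by
  induction a generalizing s with
  | zero =>
    have h0 : Exchanges x y (fun _ => 1) 0 := fun _ _ _ _ hs => absurd hs (Nat.not_lt_zero _)
    exact h0.stair_mul_fill h z b hj (by simpa using hs)
  | succ a ih =>
    rw [Nat.mul_succ] at hs
    have h1 : normalForm x y e z (a + 1) b s =
        stair x y (e + 1) (min s (e + 1)) * normalForm x y e z a b (s - (e + 1)) := by
      simp [normalForm, fill]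
    rw [h1, mul_left_comm, ih (by omega), stair_mul_normalForm h z (by omega)
      (by rw [Nat.mul_succ]; omega)]
    congr 1; omega

theorem map_stair {B : Type*} [CommRing B] (φ : A →+* B) {τ : ℕ → B} {p q : B}
    (hx : ∀ t, φ (x t) = τ t * p) (hy : ∀ t, φ (y t) = τ t * q) {n i : ℕ} (hi : i ≤ n) :
    φ (stair x y n i) = (∏ t ∈ Finset.range n, τ t) * p ^ i * q ^ (n - i) := by
  rw [stair, map_mul, map_prod, map_prod, ← Finset.prod_range_mul_prod_Ico τ hi]
  simp only [hx, hy, Finset.prod_mul_distrib, Finset.prod_const, Finset.card_range, Nat.card_Ico]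
  ring

theorem map_fill {B : Type*} [CommRing B] (φ : A →+* B) {τ : ℕ → B} {p q : B}
    (hx : ∀ t, φ (x t) = τ t * p) (hy : ∀ t, φ (y t) = τ t * q) {f : ℕ → A} {C : ℕ} {M : B}
    (hf : ∀ s ≤ C, φ (f s) = M * p ^ s * q ^ (C - s)) (n : ℕ) (c : A) (a : ℕ) {s : ℕ}
    (hs : s ≤ n * a + C) :
    φ (fill x y n c f a s) =
      (φ c * ∏ t ∈ Finset.range n, τ t) ^ a * M * p ^ s * q ^ (n * a + C - s) := by
  induction a generalizing s with
  | zero => simpa [fill] using hf s (by simpa using hs)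
  | succ a ih =>
    rw [Nat.mul_succ] at hs
    have h1 : p ^ s = p ^ min s n * p ^ (s - n) := by rw [← pow_add]; congr 1; omega
    have h2 : q ^ (n * (a + 1) + C - s) = q ^ (n - min s n) * q ^ (n * a + C - (s - n)) := by
      rw [← pow_add, Nat.mul_succ]; congr 1; omega
    rw [fill, map_mul, map_mul, map_stair φ hx hy (min_le_right s n), ih (by omega), h1, h2]
    ring

theorem fill_mem {S : Type*} [SetLike S A] [SubmonoidClass S A] (R : S) {f : ℕ → A}
    (hf : ∀ i, f i ∈ R) {n : ℕ} {c : A} (hc : ∀ i ≤ n, c * stair x y n i ∈ R) (a i : ℕ) :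
    fill x y n c f a i ∈ R := by
  induction a generalizing i with
  | zero => exact hf i
  | succ a ih => exact mul_mem (hc _ (min_le_right _ _)) (ih _)

/-- The generators of the coordinate ring of the rational normal scroll inside `A`. -/
def scrollGens (x y : ℕ → A) (e : ℕ) (z : A) : Set A :=
  {r | (∃ i ≤ e + 1, r = stair x y (e + 1) i) ∨ ∃ i ≤ e, r = z * stair x y e i}

theorem exists_normalForm_of_mem_closure (h : ∀ t, x t * y (t + 1) = y t * x (t + 1)) {e : ℕ}
    {z r : A} (hr : r ∈ Submonoid.closure (scrollGens x y e z)) :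
    ∃ a b i, i ≤ (e + 1) * a + e * b ∧ r = normalForm x y e z a b i := by
  induction hr using Submonoid.closure_induction_left with
  | one => exact ⟨0, 0, 0, by simp, rfl⟩
  | mul_left g hg r _ ih =>
    obtain ⟨a, b, s, hs, rfl⟩ := ih
    rcases hg with ⟨j, hj, rfl⟩ | ⟨j, hj, rfl⟩
    · exact ⟨a + 1, b, s + j, by rw [Nat.mul_succ]; omega, stair_mul_normalForm h z hj hs⟩
    · exact ⟨a, b + 1, s + j, by rw [Nat.mul_succ]; omega,
        mul_stair_mul_normalForm h z hj hs⟩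

variable {k : Type*} [Field k]

theorem monomial_eq_prod_four (s : Fin 4 →₀ ℕ) :
    monomial s (1 : k) = X 0 ^ s 0 * X 1 ^ s 1 * X 2 ^ s 2 * X 3 ^ s 3 := by
  rw [monomial_eq, Finsupp.prod_fintype _ _ (by simp), Fin.prod_univ_four]
  simp

/-- The scaling of column `t` in the parametrization of the scroll: `1` before the last column `e`,
`X 0` in column `e`, and `0` beyond it. -/
noncomputable def colParam (k : Type*) [Field k] (e t : ℕ) : MvPolynomial (Fin 4) k :=
  if t < e then 1 else if t = e then X 0 else 0

theorem prod_colParam (e : ℕ) : ∏ t ∈ Finset.range e, colParam k e t = 1 :=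
  Finset.prod_eq_one fun _ ht => if_pos (Finset.mem_range.1 ht)

theorem prod_colParam_succ (e : ℕ) : ∏ t ∈ Finset.range (e + 1), colParam k e t = X 0 := by
  rw [Finset.prod_range_succ, prod_colParam, one_mul, colParam, if_neg (lt_irrefl e), if_pos rfl]

section Parametrization

variable [Algebra k A] {e : ℕ} {z : A} (φ : A →ₐ[k] MvPolynomial (Fin 4) k)

theorem map_normalForm (hx : ∀ t, φ (x t) = colParam k e t * X 2)
    (hy : ∀ t, φ (y t) = colParam k e t * X 3) (hz : φ z = X 1) {a b i : ℕ}
    (hi : i ≤ (e + 1) * a + e * b) :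
    φ (normalForm x y e z a b i) =
      X 0 ^ a * X 1 ^ b * X 2 ^ i * X 3 ^ ((e + 1) * a + e * b - i) := by
  have h0 : ∀ s ≤ 0, (φ : A →+* MvPolynomial (Fin 4) k) 1 = 1 * X 2 ^ s * X 3 ^ (0 - s) := by
    rintro s hs
    obtain rfl := Nat.le_zero.1 hs
    simp
  have h1 := fun s (hs : s ≤ e * b) =>
    map_fill (φ : A →+* MvPolynomial (Fin 4) k) hx hy h0 e z b (s := s) hs
  have h2 := map_fill (φ : A →+* MvPolynomial (Fin 4) k) hx hy h1 (e + 1) 1 a hi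
  simpa [prod_colParam, prod_colParam_succ, hz, normalForm] using h2

theorem eq_zero_of_map_eq_zero (h : ∀ t, x t * y (t + 1) = y t * x (t + 1))
    (hx : ∀ t, φ (x t) = colParam k e t * X 2) (hy : ∀ t, φ (y t) = colParam k e t * X 3)
    (hz : φ z = X 1) {r : A} (hr : r ∈ Algebra.adjoin k (scrollGens x y e z)) (h0 : φ r = 0) :
    r = 0 := by
  let σ : MvPolynomial (Fin 4) k →ₗ[k] A :=
    (basisMonomials (Fin 4) k).constr k fun s => normalForm x y e z (s 0) (s 1) (s 2)
  suffices hσ : σ (φ r) = r by rw [← hσ, h0, map_zero]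
  clear h0
  rw [← Subalgebra.mem_toSubmodule, Algebra.adjoin_eq_span] at hr
  induction hr using Submodule.span_induction with
  | mem r hr =>
    obtain ⟨a, b, i, hi, rfl⟩ := exists_normalForm_of_mem_closure h hr
    have hm := monomial_eq_prod_four (k := k)
      (Finsupp.equivFunOnFinite.symm ![a, b, i, (e + 1) * a + e * b - i])
    have hφ := map_normalForm φ hx hy hz hi
    simp only [Finsupp.equivFunOnFinite_symm_apply_apply, Matrix.cons_val] at hm
    rw [hφ, ← hm]
    exact (basisMonomials (Fin 4) k).constr_basis k _ _
  | zero => simp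
  | add r s _ _ hr hs => simp [hr, hs]
  | smul c r _ hr => simp [hr]

/-- The weights on `k[X 0, X 1, X 2, X 3]` whose weight zero part is the coordinate ring of the
scroll. -/
def scrollWeight (e : ℕ) : Fin 4 → ℤ := ![-(e + 1), -e, 1, 1]

theorem exists_map_eq_of_isWeightedHomogeneous
    (hx : ∀ t, φ (x t) = colParam k e t * X 2) (hy : ∀ t, φ (y t) = colParam k e t * X 3)
    (hz : φ z = X 1) {c : MvPolynomial (Fin 4) k}
    (hc : IsWeightedHomogeneous (scrollWeight e) c 0) :
    ∃ r ∈ Algebra.adjoin k (scrollGens x y e z), φ r = c := by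
  have hN : ∀ a b i, normalForm x y e z a b i ∈ Algebra.adjoin k (scrollGens x y e z) :=
    fun a b i => fill_mem _ (fun i => fill_mem _ (fun _ => one_mem _)
      (fun i hi => Algebra.subset_adjoin (s := scrollGens x y e z) (Or.inr ⟨i, hi, rfl⟩)) b i)
      (fun i hi => Algebra.subset_adjoin (s := scrollGens x y e z)
        (Or.inl ⟨i, hi, one_mul _⟩)) a i
  refine ⟨∑ s ∈ c.support, c.coeff s • normalForm x y e z (s 0) (s 1) (s 2),
    sum_mem fun s _ => Subalgebra.smul_mem _ (hN _ _ _) _, ?_⟩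
  conv_rhs => rw [c.as_sum]
  rw [map_sum]
  refine Finset.sum_congr rfl fun s hs => ?_
  have hw : (-((e : ℤ) + 1) * s 0 + -e * s 1 + s 2 + s 3 : ℤ) = 0 := by
    have := hc (mem_support_iff.1 hs)
    rw [Finsupp.weight_apply, Finsupp.sum_fintype _ _ (by simp), Fin.sum_univ_four] at this
    simp [scrollWeight] at this
    linarith
  have hw' : s 2 + s 3 = (e + 1) * s 0 + e * s 1 := by zify; linarith
  rw [map_smul, map_normalForm φ hx hy hz (by omega), ← hw', Nat.add_sub_cancel_left,
    ← monomial_eq_prod_four, smul_monomial, smul_eq_mul, mul_one]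

theorem isWeightedHomogeneous_map
    (h : ∀ t, x t * y (t + 1) = y t * x (t + 1))
    (hx : ∀ t, φ (x t) = colParam k e t * X 2) (hy : ∀ t, φ (y t) = colParam k e t * X 3)
    (hz : φ z = X 1) {r : A} (hr : r ∈ Algebra.adjoin k (scrollGens x y e z)) :
    IsWeightedHomogeneous (scrollWeight e) (φ r) 0 := by
  rw [← Subalgebra.mem_toSubmodule, Algebra.adjoin_eq_span] at hr
  induction hr using Submodule.span_induction with
  | mem r hr =>
    obtain ⟨a, b, i, hi, rfl⟩ := exists_normalForm_of_mem_closure h hr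
    have hX := isWeightedHomogeneous_X k (scrollWeight e)
    rw [map_normalForm φ hx hy hz hi]
    convert ((((hX 0).pow a).mul ((hX 1).pow b)).mul ((hX 2).pow i)).mul ((hX 3).pow _) using 1
    simp [scrollWeight, Nat.cast_sub hi]
    ring
  | zero => simpa using isWeightedHomogeneous_zero k _ _
  | add r s _ _ hr hs => simpa using hr.add hs
  | smul c r _ hr => simpa using (weightedHomogeneousSubmodule k (scrollWeight e) 0).smul_mem c hr

end Parametrization

theorem exists_isWeightedHomogeneous_mul_eq {c f u : MvPolynomial (Fin 4) k} {w : Fin 4 → ℤ}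
    (hu : IsWeightedHomogeneous w u 0) (hf : IsWeightedHomogeneous w f 0) (h : f = c * u) :
    ∃ c', IsWeightedHomogeneous w c' 0 ∧ f = c' * u := by
  let _ := weightedGradedAlgebra k w
  refine ⟨weightedHomogeneousComponent w 0 c,
    weightedHomogeneousComponent_isWeightedHomogeneous _ _, ?_⟩
  have hcu := DirectSum.coe_decompose_mul_of_right_mem_zero
    (weightedHomogeneousSubmodule k w) (i := 0) (a := c) (b := u) hu
  have hdec (g : MvPolynomial (Fin 4) k) :
      (DirectSum.decompose (weightedHomogeneousSubmodule k w) g 0 : MvPolynomial (Fin 4) k) =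
        weightedHomogeneousComponent w 0 g :=
    weightedDecomposition.decompose'_apply k w g 0
  rwa [← h, hdec, hdec, weightedHomogeneousComponent_eq_self hf] at hcu

theorem isRelPrime_uv (e : ℕ) :
    IsRelPrime (X 0 * X 2 ^ (e + 1) + X 1 * X 2 ^ e : MvPolynomial (Fin 4) k)
      (X 0 * X 3 ^ (e + 1) + X 1 * X 3 ^ e) := by
  have hev (g : MvPolynomial (Fin 4) k) (hg : eval ![1, 0, 0, 1] g = 0) :
      ¬ g ∣ (X 0 * X 3 ^ (e + 1) + X 1 * X 3 ^ e) := by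
    rintro ⟨r, hr⟩
    simpa [hg] using congrArg (eval ![1, 0, 0, 1]) hr
  have hirr : Irreducible (1 * X 1 + X 0 * X 2 : MvPolynomial (Fin 4) k) := by
    refine irreducible_mul_X_add _ _ _ one_ne_zero (by simp) ?_ isRelPrime_one_left
    intro h1
    have := vars_mul _ _ h1
    simp [vars_X] at this
  have h2 : (X 0 * X 2 ^ (e + 1) + X 1 * X 2 ^ e : MvPolynomial (Fin 4) k) =
      X 2 ^ e * (1 * X 1 + X 0 * X 2) := by ring
  rw [h2]
  exact ((X_prime (i := 2)).irreducible.isRelPrime_iff_not_dvd.2 (hev _ (by simp))).pow_left.mul_left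
    (hirr.isRelPrime_iff_not_dvd.2 (hev _ (by simp)))

theorem u_ne_zero (e : ℕ) :
    (X 0 * X 2 ^ (e + 1) + X 1 * X 2 ^ e : MvPolynomial (Fin 4) k) ≠ 0 := by
  intro h
  simpa using congrArg (eval ![1, 0, 1, 0]) h

theorem isWeightedHomogeneous_u (e : ℕ) : IsWeightedHomogeneous (scrollWeight e)
    (X 0 * X 2 ^ (e + 1) + X 1 * X 2 ^ e : MvPolynomial (Fin 4) k) 0 := by
  have hX := isWeightedHomogeneous_X k (scrollWeight e)
  refine IsWeightedHomogeneous.add ?_ ?_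
  · convert (hX 0).mul ((hX 2).pow (e + 1)) using 1
    simp [scrollWeight]
  · convert (hX 1).mul ((hX 2).pow e) using 1
    simp [scrollWeight]

end PathMinors

section Concrete

open PathMinors

/-- The class in `S(d)/K(d)` of the variable of type `c` in column `t`, and `0` if there is no
such column. -/
noncomputable def colVar (k : Type) [Field k] (d : ℕ) (c : Fin 3) (t : ℕ) : Sd k d ⧸ KK k d :=
  if h : t < d then Ideal.Quotient.mk (KK k d) (X (⟨t, h⟩, c)) else 0

theorem colVar_swap (k : Type) [Field k] (d t : ℕ) :
    colVar k d 0 t * colVar k d 1 (t + 1) = colVar k d 1 t * colVar k d 0 (t + 1) := by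
  by_cases h : t + 1 < d
  · rw [colVar, colVar, colVar, colVar, dif_pos h, dif_pos h, dif_pos (by omega),
      dif_pos (by omega), ← map_mul, ← map_mul, Ideal.Quotient.eq]
    exact Ideal.subset_span ⟨t, h, Or.inl rfl⟩
  · simp [colVar, h]

theorem mm_eq_prod_range (k : Type) [Field k] (d i j : ℕ) :
    mm k d i j = ∏ t ∈ Finset.range d,
      if t < i then colVar k d 0 t else if t < i + j then colVar k d 1 t else colVar k d 2 t := by
  rw [mm, map_prod, Finset.prod_range]
  refine Finset.prod_congr rfl fun t _ => ?_
  simp only [colVar, t.2, dif_pos, xv, yv, zv, Fin.eta]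
  split_ifs <;> rfl

theorem prod_range_ite_eq_stair {A : Type*} [CommRing A] (x y z : ℕ → A) {n i m : ℕ} (hi : i ≤ n)
    (hm : n ≤ m) :
    (∏ t ∈ Finset.range n, if t < i then x t else if t < m then y t else z t) =
      stair x y n i := by
  rw [stair, ← Finset.prod_range_mul_prod_Ico _ hi]
  congr 1
  · exact Finset.prod_congr rfl fun t ht => if_pos (Finset.mem_range.1 ht)
  · refine Finset.prod_congr rfl fun t ht => ?_
    rw [Finset.mem_Ico] at ht
    rw [if_neg (by omega), if_pos (by omega)]

theorem mm_eq_stair (k : Type) [Field k] {d i j : ℕ} (h : i + j = d) :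
    mm k d i j = stair (colVar k d 0) (colVar k d 1) d i := by
  rw [mm_eq_prod_range, prod_range_ite_eq_stair _ _ _ (by omega) h.ge]

theorem mm_eq_mul_stair (k : Type) [Field k] {e i j : ℕ} (h : i + j = e) :
    mm k (e + 1) i j =
      colVar k (e + 1) 2 e * stair (colVar k (e + 1) 0) (colVar k (e + 1) 1) e i := by
  rw [mm_eq_prod_range, Finset.prod_range_succ, prod_range_ite_eq_stair _ _ _ (by omega) h.ge,
    if_neg (by omega), if_neg (by omega), mul_comm]

theorem Rdl_one_eq_adjoin (k : Type) [Field k] (e : ℕ) :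
    Rdl k (e + 1) 1 = Algebra.adjoin k
      (scrollGens (colVar k (e + 1) 0) (colVar k (e + 1) 1) e (colVar k (e + 1) 2 e)) := by
  rw [Rdl]
  congr 1
  ext r
  constructor
  · rintro ⟨j, hj, i, hi, rfl⟩
    rcases Nat.le_one_iff_eq_zero_or_eq_one.1 hj with rfl | rfl
    · exact Or.inl ⟨i, hi, mm_eq_stair k (by omega)⟩
    · exact Or.inr ⟨i, hi, mm_eq_mul_stair k (by omega)⟩
  · rintro (⟨i, hi, rfl⟩ | ⟨i, hi, rfl⟩)
    · exact ⟨0, zero_le_one, i, hi, (mm_eq_stair k (by omega)).symm⟩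
    · exact ⟨1, le_rfl, i, hi, (mm_eq_mul_stair k (by omega)).symm⟩

/-- The parametrization of the scroll, as a map out of `S(e + 1)/K(e + 1)`. -/
noncomputable def scrollMap (k : Type) [Field k] (e : ℕ) :
    (Sd k (e + 1) ⧸ KK k (e + 1)) →ₐ[k] MvPolynomial (Fin 4) k :=
  Ideal.Quotient.liftₐ (KK k (e + 1))
    (aeval fun v : Fin (e + 1) × Fin 3 =>
      (![colParam k e v.1 * X 2, colParam k e v.1 * X 3, if (v.1 : ℕ) = e then X 1 else 0] :
        Fin 3 → MvPolynomial (Fin 4) k) v.2) <| by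
    intro a ha
    rw [← RingHom.mem_ker]
    revert a
    change KK k (e + 1) ≤ _
    refine Ideal.span_le.2 ?_
    rintro p ⟨t, ht, rfl | rfl | rfl⟩ <;> rw [SetLike.mem_coe, RingHom.mem_ker]
    · simp [xv, yv]
      ring
    · simp [xv, zv, show t ≠ e by omega]
    · simp [yv, zv, show t ≠ e by omega]

theorem scrollMap_mk_X (k : Type) [Field k] (e : ℕ) (v : Fin (e + 1) × Fin 3) :
    scrollMap k e (Ideal.Quotient.mk _ (X v)) =
      (![colParam k e v.1 * X 2, colParam k e v.1 * X 3, if (v.1 : ℕ) = e then X 1 else 0] :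
        Fin 3 → MvPolynomial (Fin 4) k) v.2 :=
  (Ideal.Quotient.liftₐ_apply _ _ _ _).trans (aeval_X _ v)

theorem scrollMap_colVar_zero (k : Type) [Field k] (e t : ℕ) :
    scrollMap k e (colVar k (e + 1) 0 t) = colParam k e t * X 2 := by
  rw [colVar]
  split_ifs with h
  · exact scrollMap_mk_X k e _
  · simp [colParam, show ¬ t < e by omega, show t ≠ e by omega]

theorem scrollMap_colVar_one (k : Type) [Field k] (e t : ℕ) :
    scrollMap k e (colVar k (e + 1) 1 t) = colParam k e t * X 3 := by
  rw [colVar]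
  split_ifs with h
  · exact scrollMap_mk_X k e _
  · simp [colParam, show ¬ t < e by omega, show t ≠ e by omega]

theorem scrollMap_colVar_two (k : Type) [Field k] (e : ℕ) :
    scrollMap k e (colVar k (e + 1) 2 e) = X 1 := by
  rw [colVar, dif_pos e.lt_succ_self, scrollMap_mk_X]
  simp

theorem scrollMap_mm (k : Type) [Field k] {e i j : ℕ} (h : i + j = e + 1) :
    scrollMap k e (mm k (e + 1) i j) = X 0 * X 2 ^ i * X 3 ^ j := by
  have hs := map_stair (x := colVar k (e + 1) 0) (y := colVar k (e + 1) 1)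
    (RingHomClass.toRingHom (scrollMap k e)) (scrollMap_colVar_zero k e)
    (scrollMap_colVar_one k e) (n := e + 1) (i := i) (by omega)
  rw [prod_colParam_succ, show e + 1 - i = j by omega] at hs
  rw [mm_eq_stair k h]
  exact hs

theorem scrollMap_mm_pred (k : Type) [Field k] {e i j : ℕ} (h : i + j = e) :
    scrollMap k e (mm k (e + 1) i j) = X 1 * X 2 ^ i * X 3 ^ j := by
  have hs := map_stair (x := colVar k (e + 1) 0) (y := colVar k (e + 1) 1)
    (RingHomClass.toRingHom (scrollMap k e)) (scrollMap_colVar_zero k e)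
    (scrollMap_colVar_one k e) (n := e) (i := i) (by omega)
  rw [prod_colParam, one_mul, show e - i = j by omega] at hs
  rw [mm_eq_mul_stair k h, map_mul, scrollMap_colVar_two, mul_assoc]
  exact congrArg _ hs

end Concrete

/-- Statement 16: `{u_{d,1}, v_{d,1}}` with `u_{d,1} = m_{d,0,0} + m_{d−1,0,1}`
and `v_{d,1} = m_{0,d,0} + m_{0,d−1,1}` is a regular sequence in `R(d,1)`:
`u_{d,1}` is a non-zero-divisor in `R(d,1)`, and `v_{d,1}` is a
non-zero-divisor modulo the ideal of `R(d,1)` generated by `u_{d,1}`. -/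
theorem statement_16 (k : Type) [Field k] (d : ℕ) (hd : 2 ≤ d) :
    (∀ a ∈ Rdl k d 1, a * (mm k d d 0 + mm k d (d - 1) 0) = 0 → a = 0) ∧
    (∀ a ∈ Rdl k d 1,
      (∃ b ∈ Rdl k d 1,
        a * (mm k d 0 d + mm k d 0 (d - 1)) = b * (mm k d d 0 + mm k d (d - 1) 0)) →
      ∃ c ∈ Rdl k d 1, a = c * (mm k d d 0 + mm k d (d - 1) 0)) := by
  obtain ⟨e, rfl⟩ : ∃ e, d = e + 1 := ⟨d - 1, by omega⟩
  rw [Nat.add_sub_cancel]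
  have hswap := colVar_swap k (e + 1)
  have hx := scrollMap_colVar_zero k e
  have hy := scrollMap_colVar_one k e
  have hz := scrollMap_colVar_two k e
  have hu : scrollMap k e (mm k (e + 1) (e + 1) 0 + mm k (e + 1) e 0) =
      X 0 * X 2 ^ (e + 1) + X 1 * X 2 ^ e := by
    rw [map_add, scrollMap_mm k (add_zero _), scrollMap_mm_pred k (add_zero _), pow_zero,
      mul_one, mul_one]
  have hv : scrollMap k e (mm k (e + 1) 0 (e + 1) + mm k (e + 1) 0 e) =
      X 0 * X 3 ^ (e + 1) + X 1 * X 3 ^ e := by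
    rw [map_add, scrollMap_mm k (zero_add _), scrollMap_mm_pred k (zero_add _), pow_zero,
      mul_one, mul_one]
  have hinj {r} (hr : r ∈ Rdl k (e + 1) 1) : scrollMap k e r = 0 → r = 0 :=
    PathMinors.eq_zero_of_map_eq_zero (scrollMap k e) hswap hx hy hz (Rdl_one_eq_adjoin k e ▸ hr)
  have huR : mm k (e + 1) (e + 1) 0 + mm k (e + 1) e 0 ∈ Rdl k (e + 1) 1 :=
    add_mem
      (Algebra.subset_adjoin ⟨0, zero_le_one, e + 1, le_rfl, by simp⟩)
      (Algebra.subset_adjoin ⟨1, le_rfl, e, le_rfl, by simp⟩)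
  refine ⟨fun a ha h0 => hinj ha ?_, fun a ha ⟨b, hb, hab⟩ => ?_⟩
  · have hφ := congrArg (scrollMap k e) h0
    rw [map_mul, hu, map_zero] at hφ
    exact (mul_eq_zero.1 hφ).resolve_right (PathMinors.u_ne_zero e)
  · have hφ := congrArg (scrollMap k e) hab
    rw [map_mul, map_mul, hu, hv] at hφ
    obtain ⟨c, hc⟩ := (PathMinors.isRelPrime_uv e).dvd_of_dvd_mul_right
      (Dvd.intro_left _ hφ.symm)
    obtain ⟨c', hc', hac⟩ := PathMinors.exists_isWeightedHomogeneous_mul_eq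
      (PathMinors.isWeightedHomogeneous_u e)
      (PathMinors.isWeightedHomogeneous_map (scrollMap k e) hswap hx hy hz
        (Rdl_one_eq_adjoin k e ▸ ha)) (hc.trans (mul_comm _ _))
    obtain ⟨r, hr, rfl⟩ := PathMinors.exists_map_eq_of_isWeightedHomogeneous
      (scrollMap k e) hx hy hz hc'
    rw [← Rdl_one_eq_adjoin] at hr
    refine ⟨r, hr, sub_eq_zero.1 (hinj (sub_mem ha (mul_mem hr huR)) ?_)⟩
    rw [map_sub, map_mul, hu, hac, sub_self]
end

section
/- Let k be a field and d ≥ 2. With S(d) = k[x_i,y_i,z_i : 0 ≤ i ≤ d−1], K(d) = (x_i y_{i+1} − y_i x_{i+1}, z_i x_{i+1}, z_i y_{i+1} : 0 ≤ i ≤ d−2), m_{i,j,l} the class of x_0⋯x_{i−1} y_i⋯y_{i+j−1} z_{i+j}⋯z_{d−1} in S(d)/K(d), and R(d,l) the k-subalgebra of S(d)/K(d) generated by {m_{i,d−i−j,j} : 0 ≤ j ≤ l}, the following holds: for all 1 ≤ l ≤ d, the pair {u_{d,l}, v_{d,l}} with u_{d,l} = Σ_{i=0}^{l} m_{d−i,0,i}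 and v_{d,l} = Σ_{j=0}^{l} m_{0,d−j,j} is a regular sequence in R(d,l). In particular, taking l = d, {u_{d,d}, v_{d,d}} is a regular sequence in the full subalgebra U = R(d,d) generated by all the m_{i,j,l}; consequently U has depth at least 2 at its irrelevant ideal. -/
open MvPolynomial

noncomputable section

namespace RegularSequence

section Components

variable (k : Type) [Field k]

/-- The coordinate ring `k[s, t, p, q]`, with `s = X 0`, `t = X 1`, `p = X 2`, `q = X 3`. -/
abbrev Coord := MvPolynomial (Fin 4) k

/-- The exponent of `s ^ i * t ^ j * p ^ a * q ^ b`. -/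
def expo (i j a b : ℕ) : Fin 4 →₀ ℕ :=
  Finsupp.equivFunOnFinite.symm ![i, j, a, b]

lemma monomial_expo (i j a b : ℕ) :
    monomial (expo i j a b) (1 : k) = X 0 ^ i * X 1 ^ j * X 2 ^ a * X 3 ^ b := by
  rw [monomial_eq, Finsupp.prod_fintype _ _ (by simp)]
  simp [expo, Fin.prod_univ_four]

/-- The weight for which the image of the `e`-th component map has degree zero. -/
def wt (e : ℕ) : Fin 4 → ℤ := ![1, 1, -(e + 1 : ℤ), -(e : ℤ)]

lemma weight_wt (e : ℕ) (μ : Fin 4 →₀ ℕ) :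
    Finsupp.weight (wt e) μ = (μ 0 + μ 1 : ℤ) - (e + 1) * μ 2 - e * μ 3 := by
  rw [Finsupp.weight_apply, Finsupp.sum_fintype _ _ (by simp)]
  simp [wt, Fin.sum_univ_four]
  ring

variable {k}

lemma exists_homogeneous_quotient (e : ℕ) {a g u : Coord k}
    (ha : IsWeightedHomogeneous (wt e) a 0) (hu : IsWeightedHomogeneous (wt e) u 0)
    (h : a = g * u) : ∃ g', IsWeightedHomogeneous (wt e) g' 0 ∧ a = g' * u := by
  classical
  let := weightedGradedAlgebra k (wt e)
  refine ⟨DirectSum.decompose (weightedHomogeneousSubmodule k (wt e)) g 0,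
    (DirectSum.decompose (weightedHomogeneousSubmodule k (wt e)) g 0).2, ?_⟩
  rw [← DirectSum.coe_decompose_mul_of_right_mem_zero _ hu, ← h,
    DirectSum.decompose_of_mem_same _ ha]

/-- Image of `u` under the `e`-th component map. -/
def uCoord (k : Type) [Field k] (e : ℕ) : Coord k := X 0 ^ (e + 1) * X 2 + X 0 ^ e * X 3

/-- Image of `v` under the `e`-th component map. -/
def vCoord (k : Type) [Field k] (e : ℕ) : Coord k := X 1 ^ (e + 1) * X 2 + X 1 ^ e * X 3

lemma isWeightedHomogeneous_uCoord (e : ℕ) : IsWeightedHomogeneous (wt e) (uCoord k e) 0 := by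
  have h1 : (X 0 ^ (e + 1) * X 2 : Coord k) = monomial (expo (e + 1) 0 1 0) 1 := by
    simp [monomial_expo]
  have h2 : (X 0 ^ e * X 3 : Coord k) = monomial (expo e 0 0 1) 1 := by
    simp [monomial_expo]
  rw [uCoord, h1, h2]
  refine IsWeightedHomogeneous.add ?_ ?_ <;>
  · apply isWeightedHomogeneous_monomial
    rw [weight_wt]
    simp [expo]

lemma irreducible_linear : Irreducible (X 0 * X 2 + X 3 : Coord k) := by
  classical
  have h := irreducible_mul_X_add (1 : Coord k) (X 0 * X 2) 3 one_ne_zero (by simp)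
    (fun h => by
      have := vars_mul _ _ h
      simp [vars_X] at this) isRelPrime_one_left
  rwa [one_mul, add_comm] at h

lemma uCoord_ne_zero (e : ℕ) : uCoord k e ≠ 0 := by
  have : uCoord k e = X 0 ^ e * (X 0 * X 2 + X 3) := by rw [uCoord]; ring
  rw [this]
  exact mul_ne_zero (pow_ne_zero _ (X_ne_zero _)) irreducible_linear.ne_zero

lemma isRelPrime_uCoord_vCoord (e : ℕ) : IsRelPrime (uCoord k e) (vCoord k e) := by
  have hu : uCoord k e = X 0 ^ e * (X 0 * X 2 + X 3) := by rw [uCoord]; ring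
  have hv : vCoord k e = X 1 ^ e * (X 1 * X 2 + X 3) := by rw [vCoord]; ring
  have hX : Irreducible (X 0 : Coord k) := X_prime.irreducible
  have key : ∀ {f g : Coord k} (φ : Coord k →ₐ[k] Coord k), φ f = 0 → φ g ≠ 0 → ¬ f ∣ g := by
    rintro f g φ hf hg ⟨c, rfl⟩
    simp [hf] at hg
  have h1 : IsRelPrime (X 0 : Coord k) (X 1) := by
    rw [hX.isRelPrime_iff_not_dvd]
    exact key (aeval ![0, X 1, X 2, X 3]) (by simp) (by simp)
  have h2 : IsRelPrime (X 0 : Coord k) (X 1 * X 2 + X 3) := by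
    rw [hX.isRelPrime_iff_not_dvd]
    exact key (aeval ![0, 0, 0, X 3]) (by simp) (by simp)
  have h3 : IsRelPrime (X 0 * X 2 + X 3 : Coord k) (X 1) := by
    rw [irreducible_linear.isRelPrime_iff_not_dvd]
    exact key (aeval ![0, X 1, 0, 0]) (by simp) (by simp)
  have h4 : IsRelPrime (X 0 * X 2 + X 3 : Coord k) (X 1 * X 2 + X 3) := by
    rw [irreducible_linear.isRelPrime_iff_not_dvd]
    exact key (aeval ![0, X 1, X 2, 0]) (by simp) (by simp)
  rw [hu, hv]
  exact ((h1.pow).mul_right h2.pow_left).mul_left (h3.pow_right.mul_right h4)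

/-- Setting `q = 0`. -/
def killQ : Coord k →ₐ[k] Coord k := aeval ![X 0, X 1, X 2, 0]

/-- Setting `p = 0` and renaming `q` to `p`. -/
def shiftQ : Coord k →ₐ[k] Coord k := aeval ![X 0, X 1, 0, X 2]

lemma killQ_uCoord_ne_zero (e : ℕ) : killQ (uCoord k e) ≠ 0 := by
  simp [killQ, uCoord]

lemma X_dvd_of_killQ_eq_zero {g : Coord k} (h : killQ g = 0) : X 3 ∣ g := by
  have hc : (Ideal.Quotient.mkₐ k (Ideal.span {(X 3 : Coord k)})).comp killQ =
      Ideal.Quotient.mkₐ k (Ideal.span {(X 3 : Coord k)}) := by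
    ext i
    fin_cases i <;> simp [killQ]
  have := DFunLike.congr_fun hc g
  rw [AlgHom.comp_apply, h, map_zero, eq_comm] at this
  exact Ideal.mem_span_singleton.1 (Ideal.Quotient.eq_zero_iff_mem.1 this)

lemma one_le_of_mem_support {g : Coord k} (h : killQ g = 0) {μ : Fin 4 →₀ ℕ}
    (hμ : μ ∈ g.support) : 1 ≤ μ 3 := by
  obtain ⟨c, rfl⟩ := X_dvd_of_killQ_eq_zero h
  classical
  rw [mem_support_iff, coeff_X_mul'] at hμ
  by_contra h0
  exact hμ (if_neg (by simpa using h0))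

end Components

section Quotient

variable (k : Type) [Field k] (d : ℕ)

/-- The class of the variable `x_t` (`c = 0`), `y_t` (`c = 1`) or `z_t` (`c = 2`). -/
def cl (c : Fin 3) (t : ℕ) : Sd k d ⧸ KK k d :=
  if h : t < d then Ideal.Quotient.mk (KK k d) (X (⟨t, h⟩, c)) else 0

lemma cl_comm (t : ℕ) : cl k d 0 t * cl k d 1 (t + 1) = cl k d 1 t * cl k d 0 (t + 1) := by
  by_cases h : t + 1 < d
  · rw [cl, cl, cl, cl, dif_pos h, dif_pos h, dif_pos (by omega), dif_pos (by omega),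
      ← map_mul, ← map_mul, Ideal.Quotient.mk_eq_mk_iff_sub_mem]
    exact Ideal.subset_span ⟨t, h, Or.inl rfl⟩
  · simp [cl, h]

lemma cl_two_mul_zero (t : ℕ) : cl k d 2 t * cl k d 0 (t + 1) = 0 := by
  by_cases h : t + 1 < d
  · rw [cl, cl, dif_pos h, dif_pos (by omega), ← map_mul, Ideal.Quotient.eq_zero_iff_mem]
    exact Ideal.subset_span ⟨t, h, Or.inr (Or.inl rfl)⟩
  · simp [cl, h]

lemma cl_two_mul_one (t : ℕ) : cl k d 2 t * cl k d 1 (t + 1) = 0 := by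
  by_cases h : t + 1 < d
  · rw [cl, cl, dif_pos h, dif_pos (by omega), ← map_mul, Ideal.Quotient.eq_zero_iff_mem]
    exact Ideal.subset_span ⟨t, h, Or.inr (Or.inr rfl)⟩
  · simp [cl, h]

lemma prod_cl_exchange (i j : ℕ) :
    (∏ t ∈ Finset.range (i + 1), cl k d 0 t) * (∏ t ∈ Finset.range j, cl k d 0 t) * cl k d 1 j =
      (∏ t ∈ Finset.range (j + 1), cl k d 0 t) * (∏ t ∈ Finset.range i, cl k d 0 t) *
        cl k d 1 i := by
  wlog hij : i ≤ j generalizing i j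
  · exact (this j i (by omega)).symm
  induction j, hij using Nat.le_induction with
  | base => rfl
  | succ j _ ih =>
    rw [Finset.prod_range_succ _ (j + 1)]
    calc _ = (∏ t ∈ Finset.range (i + 1), cl k d 0 t) * (∏ t ∈ Finset.range j, cl k d 0 t) *
          (cl k d 0 j * cl k d 1 (j + 1)) := by rw [Finset.prod_range_succ _ j]; ring
      _ = (∏ t ∈ Finset.range (i + 1), cl k d 0 t) * (∏ t ∈ Finset.range j, cl k d 0 t) *
          cl k d 1 j * cl k d 0 (j + 1) := by rw [cl_comm]; ring
      _ = _ := by rw [ih]; ring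

/-- The generator `m_{i, n - i, d - n}`, of level `n`. -/
def gen (n i : ℕ) : Sd k d ⧸ KK k d := mm k d i (n - i)

lemma gen_eq {n i : ℕ} (hi : i ≤ n) (hn : n ≤ d) :
    gen k d n i = (∏ t ∈ Finset.range i, cl k d 0 t) * (∏ t ∈ Finset.Ico i n, cl k d 1 t) *
      ∏ t ∈ Finset.Ico n d, cl k d 2 t := by
  have h : gen k d n i = ∏ t ∈ Finset.range d,
      if t < i then cl k d 0 t else if t < n then cl k d 1 t else cl k d 2 t := by
    rw [Finset.prod_range, gen, mm, map_prod]
    refine Finset.prod_congr rfl fun t _ => ?_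
    rw [Nat.add_sub_cancel' hi]
    split_ifs <;> simp [cl, xv, yv, zv]
  rw [h, ← Finset.prod_range_mul_prod_Ico _ hn, ← Finset.prod_range_mul_prod_Ico _ hi]
  congr 1
  · congr 1
    · refine Finset.prod_congr rfl fun t ht => ?_
      rw [if_pos (Finset.mem_range.1 ht)]
    · refine Finset.prod_congr rfl fun t ht => ?_
      have := Finset.mem_Ico.1 ht
      rw [if_neg (by omega), if_pos (by omega)]
  · refine Finset.prod_congr rfl fun t ht => ?_
    have := Finset.mem_Ico.1 ht
    rw [if_neg (by omega), if_neg (by omega)]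

lemma gen_exchange_one {n n' i j : ℕ} (hi : i < n) (hj : j < n') (hn : n ≤ d) (hn' : n' ≤ d) :
    gen k d n (i + 1) * gen k d n' j = gen k d n i * gen k d n' (j + 1) := by
  rw [gen_eq k d hi hn, gen_eq k d hi.le hn, gen_eq k d hj hn', gen_eq k d hj.le hn',
    Finset.prod_eq_prod_Ico_succ_bot hi, Finset.prod_eq_prod_Ico_succ_bot hj]
  have := prod_cl_exchange k d i j
  linear_combination (∏ t ∈ Finset.Ico (i + 1) n, cl k d 1 t) *
    (∏ t ∈ Finset.Ico (j + 1) n', cl k d 1 t) * (∏ t ∈ Finset.Ico n d, cl k d 2 t) *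
    (∏ t ∈ Finset.Ico n' d, cl k d 2 t) * this

lemma gen_exchange {n n' i j : ℕ} (c : ℕ) (hi : i + c ≤ n) (hj : j + c ≤ n')
    (hn : n ≤ d) (hn' : n' ≤ d) :
    gen k d n (i + c) * gen k d n' j = gen k d n i * gen k d n' (j + c) := by
  induction c generalizing j with
  | zero => rfl
  | succ c ih =>
    rw [← add_assoc, gen_exchange_one k d (by omega) (by omega) hn hn', ih (by omega) (by omega)]
    congr 2
    omega

lemma gen_mul_gen_eq_zero {n n' i j : ℕ} (hi : i ≤ n) (hj : j ≤ n') (h : n + 2 ≤ n')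
    (hn' : n' ≤ d) : gen k d n i * gen k d n' j = 0 := by
  have h2 : cl k d 2 n ∣ gen k d n i := by
    rw [gen_eq k d hi (by omega)]
    exact (Finset.dvd_prod_of_mem _ (Finset.mem_Ico.2 ⟨le_rfl, by omega⟩)).mul_left _
  rw [← zero_dvd_iff]
  by_cases hc : n + 1 < j
  · rw [← cl_two_mul_zero k d n]
    refine mul_dvd_mul h2 ?_
    rw [gen_eq k d hj hn']
    exact ((Finset.dvd_prod_of_mem _ (Finset.mem_range.2 hc)).mul_right _).mul_right _
  · rw [← cl_two_mul_one k d n]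
    refine mul_dvd_mul h2 ?_
    rw [gen_eq k d hj hn']
    exact ((Finset.dvd_prod_of_mem _ (Finset.mem_Ico.2 ⟨by omega, by omega⟩)).mul_left
      _).mul_right _

/-- The product of one generator from each level in the list, with `x`-exponents adding up to `i`,
filled greedily from the left. -/
def word : List ℕ → ℕ → Sd k d ⧸ KK k d
  | [], _ => 1
  | n :: L, i => gen k d n (min i n) * word L (i - min i n)

lemma gen_mul_word {n j : ℕ} (hj : j ≤ n) (hn : n ≤ d) (L : List ℕ) (hL : ∀ m ∈ L, m ≤ d)
    {i : ℕ} (hi : i ≤ L.sum) : gen k d n j * word k d L i = word k d (n :: L) (i + j) := by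
  induction L generalizing i j with
  | nil =>
    obtain rfl : i = 0 := by simpa using hi
    simp [word, hj]
  | cons n' L ih =>
    rw [List.sum_cons] at hi
    have hn' : n' ≤ d := hL n' (by simp)
    have hL' : ∀ m ∈ L, m ≤ d := fun m hm => hL m (by simp [hm])
    have h1 : gen k d n j * word k d (n' :: L) i = gen k d n' (min i n') *
        (gen k d n j * word k d L (i - min i n')) := by
      rw [word]; ring
    rw [h1, ih hj hL' (by omega), word, word, word]
    rcases le_total n (i - min i n' + j) with h | h
    · rw [min_eq_right h, min_eq_right (show n ≤ i + j by omega),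
        show min (i + j - n) n' = min i n' by omega,
        show i + j - n - min i n' = i - min i n' + j - n by omega]
      ring
    · have hx := gen_exchange k d (n := n) (n' := n') (i := i - min i n' + j)
        (j := i + j - min (i + j) n) (min (i + j) n - (i - min i n' + j))
        (by omega) (by omega) hn hn'
      rw [show i - min i n' + j + (min (i + j) n - (i - min i n' + j)) = min (i + j) n by omega,
        show i + j - min (i + j) n + (min (i + j) n - (i - min i n' + j)) = min i n' by omega] at hx
      rw [min_eq_left h, min_eq_left (show i + j - min (i + j) n ≤ n' by omega), Nat.sub_self,
        Nat.sub_self, ← mul_assoc, ← mul_assoc, hx, mul_comm (gen k d n' _)]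

lemma gen_mul_word_append {n j : ℕ} (hj : j ≤ n) (hn : n ≤ d) (L₁ L₂ : List ℕ)
    (hL : ∀ m ∈ L₁ ++ L₂, m ≤ d) {i : ℕ} (hi : i ≤ (L₁ ++ L₂).sum) :
    gen k d n j * word k d (L₁ ++ L₂) i = word k d (L₁ ++ n :: L₂) (i + j) := by
  induction L₁ generalizing i with
  | nil => exact gen_mul_word k d hj hn L₂ hL hi
  | cons m L₁ ih =>
    rw [List.cons_append] at hL hi
    rw [List.sum_cons] at hi
    have hL' : ∀ m ∈ L₁ ++ L₂, m ≤ d := fun m hm => hL m (by simp [hm])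
    have hsum : (L₁ ++ n :: L₂).sum = n + (L₁ ++ L₂).sum := by
      simp only [List.sum_append, List.sum_cons]
      omega
    have hL'' : ∀ m ∈ L₁ ++ n :: L₂, m ≤ d := by
      intro m hm
      rcases List.mem_append.1 hm with h | h
      · exact hL' m (by simp [h])
      · rcases List.mem_cons.1 h with rfl | h
        · exact hn
        · exact hL' m (by simp [h])
    rw [List.cons_append, List.cons_append, word, mul_left_comm, ih hL' (by omega),
      gen_mul_word k d (min_le_right _ _) (hL m (by simp)) _ hL'' (by omega)]
    congr 1
    omega

end Quotient

section ComponentMap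

variable (k : Type) [Field k] (d : ℕ)

/-- Values of the variables under the `e`-th component map. -/
def compVal (e : ℕ) (v : Fin d × Fin 3) : Coord k :=
  ![X 0 * (if (v.1 : ℕ) < e then 1 else if (v.1 : ℕ) = e then X 2 else 0),
    X 1 * (if (v.1 : ℕ) < e then 1 else if (v.1 : ℕ) = e then X 2 else 0),
    if (v.1 : ℕ) < e then 0 else if (v.1 : ℕ) = e then X 3 else 1] v.2

/-- The `e`-th component map: it annihilates all generators except those of levels
`e` and `e + 1`. -/
def comp (e : ℕ) : (Sd k d ⧸ KK k d) →ₐ[k] Coord k :=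
  Ideal.Quotient.liftₐ (KK k d) (aeval (compVal k d e)) (by
    have : KK k d ≤ RingHom.ker (aeval (compVal k d e) : Sd k d →ₐ[k] Coord k) := by
      rw [KK, Ideal.span_le]
      rintro p ⟨i, h, rfl | rfl | rfl⟩ <;>
      simp only [SetLike.mem_coe, RingHom.mem_ker, xv, yv, zv, map_sub, map_mul, aeval_X,
        compVal, Matrix.cons_val] <;>
      split_ifs <;> first | omega | ring
    exact fun a ha => this ha)

lemma comp_cl (e : ℕ) (c : Fin 3) {t : ℕ} (ht : t < d) :
    comp k d e (cl k d c t) = compVal k d e (⟨t, ht⟩, c) := by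
  rw [cl, dif_pos ht]
  exact aeval_X (compVal k d e) (⟨t, ht⟩, c)

/-- The image of a generator of level `n` under the `e`-th component map, up to its
`s` and `t` factors. -/
def levVal (e n : ℕ) : Coord k := if n = e + 1 then X 2 else if n = e then X 3 else 0

lemma comp_gen {e n i : ℕ} (he : e < d) (hi : i ≤ n) (hn : n ≤ d) :
    comp k d e (gen k d n i) = X 0 ^ i * X 1 ^ (n - i) * levVal k e n := by
  have hx : ∀ t ∈ Finset.range i, comp k d e (cl k d 0 t) =
      X 0 * (if t < e then 1 else if t = e then X 2 else 0) := fun t ht => by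
    rw [comp_cl k d e 0 (by have := Finset.mem_range.1 ht; omega)]
    simp [compVal]
  have hy : ∀ t ∈ Finset.Ico i n, comp k d e (cl k d 1 t) =
      X 1 * (if t < e then 1 else if t = e then X 2 else 0) := fun t ht => by
    rw [comp_cl k d e 1 (by have := Finset.mem_Ico.1 ht; omega)]
    simp [compVal]
  have hz : ∀ t ∈ Finset.Ico n d, comp k d e (cl k d 2 t) =
      if t < e then 0 else if t = e then X 3 else 1 := fun t ht => by
    rw [comp_cl k d e 2 (by have := Finset.mem_Ico.1 ht; omega)]
    simp [compVal]
  rw [gen_eq k d hi hn, map_mul, map_mul, map_prod, map_prod, map_prod,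
    Finset.prod_congr rfl hx, Finset.prod_congr rfl hy, Finset.prod_congr rfl hz,
    Finset.prod_mul_distrib, Finset.prod_mul_distrib, Finset.prod_const, Finset.prod_const,
    Finset.card_range, Nat.card_Ico]
  have hl : (∏ t ∈ Finset.range n, (if t < e then 1 else if t = e then X 2 else 0 : Coord k)) *
      ∏ t ∈ Finset.Ico n d, (if t < e then 0 else if t = e then X 3 else 1 : Coord k) =
      levVal k e n := by
    rw [levVal]
    split_ifs with h1 h2
    · subst h1
      rw [Finset.prod_range_succ, Finset.prod_eq_one, Finset.prod_eq_one]
      · simp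
      · intro t ht
        have := Finset.mem_Ico.1 ht
        rw [if_neg (by omega), if_neg (by omega)]
      · intro t ht
        rw [if_pos (Finset.mem_range.1 ht)]
    · subst h2
      rw [Finset.prod_eq_prod_Ico_succ_bot he, Finset.prod_eq_one, Finset.prod_eq_one]
      · simp
      · intro t ht
        have := Finset.mem_Ico.1 ht
        rw [if_neg (by omega), if_neg (by omega)]
      · intro t ht
        rw [if_pos (Finset.mem_range.1 ht)]
    · rcases Nat.lt_or_gt_of_ne h2 with h | h
      · exact mul_eq_zero_of_right _
          (Finset.prod_eq_zero (Finset.mem_Ico.2 ⟨le_rfl, by omega⟩) (if_pos h))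
      · exact mul_eq_zero_of_left
          (Finset.prod_eq_zero (i := e + 1) (Finset.mem_range.2 (by omega)) (by simp)) _
  rw [← hl, ← Finset.prod_range_mul_prod_Ico _ hi]
  ring

lemma comp_word {e : ℕ} (he : e < d) (L : List ℕ) (hL : ∀ m ∈ L, m ≤ d) {i : ℕ}
    (hi : i ≤ L.sum) : comp k d e (word k d L i) =
      X 0 ^ i * X 1 ^ (L.sum - i) * (L.map (levVal k e)).prod := by
  induction L generalizing i with
  | nil =>
    obtain rfl : i = 0 := by simpa using hi
    simp [word]
  | cons n L ih =>
    rw [List.sum_cons] at hi ⊢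
    rw [word, map_mul, comp_gen k d he (by omega) (hL n (by simp)),
      ih (fun m hm => hL m (by simp [hm])) (by omega), List.map_cons, List.prod_cons,
      show n + L.sum - i = n - min i n + (L.sum - (i - min i n)) by omega, pow_add]
    have hp : (X 0 ^ i : Coord k) = X 0 ^ min i n * X 0 ^ (i - min i n) := by
      rw [← pow_add, show min i n + (i - min i n) = i by omega]
    rw [hp]
    ring

/-- `a` entries equal to `e + 1` followed by `b` entries equal to `e`. -/
def lev (e a b : ℕ) : List ℕ := List.replicate a (e + 1) ++ List.replicate b e

lemma sum_lev (e a b : ℕ) : (lev e a b).sum = (e + 1) * a + e * b := by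
  simp [lev, mul_comm]

lemma le_of_mem_lev {e a b m : ℕ} (h : m ∈ lev e a b) : m ≤ e + 1 := by
  simp only [lev, List.mem_append, List.mem_replicate] at h
  omega

lemma comp_word_lev {e : ℕ} (he : e < d) {a b i : ℕ} (hi : i ≤ (e + 1) * a + e * b) :
    comp k d e (word k d (lev e a b) i) =
      monomial (expo i ((e + 1) * a + e * b - i) a b) 1 := by
  rw [comp_word k d he _ (fun m hm => (le_of_mem_lev hm).trans he) (by rwa [sum_lev]), sum_lev,
    monomial_expo, lev]
  simp [levVal, mul_assoc]

lemma comp_word_lev_of_lt {e f : ℕ} (hef : e < f) (hf : f < d) {a b i : ℕ} (hb : 1 ≤ b)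
    (hi : i ≤ (e + 1) * a + e * b) : comp k d f (word k d (lev e a b) i) = 0 := by
  rw [comp_word k d hf _ (fun m hm => (le_of_mem_lev hm).trans (by omega)) (by rwa [sum_lev])]
  refine mul_eq_zero_of_right _ (List.prod_eq_zero (List.mem_map.2 ⟨e, ?_, ?_⟩))
  · simp [lev]; omega
  · rw [levVal, if_neg (by omega), if_neg (by omega)]

end ComponentMap

section Generators

variable (k : Type) [Field k] (d : ℕ)

/-- The generators of `R(d,l)`. -/
def gens (l : ℕ) : Set (Sd k d ⧸ KK k d) :=
  {w | ∃ n i, d - l ≤ n ∧ n ≤ d ∧ i ≤ n ∧ w = gen k d n i}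

variable {k d} {l : ℕ}

lemma Rdl_eq_adjoin (hl : l ≤ d) : Rdl k d l = Algebra.adjoin k (gens k d l) := by
  rw [Rdl]
  congr 1
  ext w
  constructor
  · rintro ⟨j, hj, i, hi, rfl⟩
    exact ⟨d - j, i, by omega, by omega, hi, by rw [gen, Nat.sub_right_comm]⟩
  · rintro ⟨n, i, h1, h2, h3, rfl⟩
    exact ⟨d - n, by omega, i, by omega, by
      rw [gen, Nat.sub_right_comm, Nat.sub_sub_self h2]⟩

lemma gen_mem_Rdl (hl : l ≤ d) {n i : ℕ} (h1 : d - l ≤ n) (h2 : n ≤ d) (hi : i ≤ n) :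
    gen k d n i ∈ Rdl k d l := by
  rw [Rdl_eq_adjoin hl]
  exact Algebra.subset_adjoin ⟨n, i, h1, h2, hi, rfl⟩

lemma word_mem_Rdl (hl : l ≤ d) {L : List ℕ} (hL : ∀ m ∈ L, d - l ≤ m ∧ m ≤ d) (i : ℕ) :
    word k d L i ∈ Rdl k d l := by
  induction L generalizing i with
  | nil => exact one_mem _
  | cons n L ih =>
    have := hL n (by simp)
    exact mul_mem (gen_mem_Rdl hl this.1 this.2 (by omega))
      (ih (fun m hm => hL m (by simp [hm])) _)

lemma isWeightedHomogeneous_comp (hl : l ≤ d) {e : ℕ} (he : e < d) {a : Sd k d ⧸ KK k d}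
    (ha : a ∈ Rdl k d l) : IsWeightedHomogeneous (wt e) (comp k d e a) 0 := by
  rw [Rdl_eq_adjoin hl] at ha
  induction ha using Algebra.adjoin_induction with
  | mem x hx =>
    obtain ⟨n, i, -, h2, h3, rfl⟩ := hx
    rw [comp_gen k d he h3 h2, levVal]
    split_ifs with h h'
    · have := monomial_expo (k := k) i (n - i) 1 0
      rw [pow_one, pow_zero, mul_one] at this
      rw [← this]
      apply isWeightedHomogeneous_monomial
      rw [weight_wt]
      simp [expo, h3]
      simp [h]
    · have := monomial_expo (k := k) i (n - i) 0 1
      rw [pow_one, pow_zero, mul_one] at this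
      rw [← this]
      apply isWeightedHomogeneous_monomial
      rw [weight_wt]
      simp [expo, h3]
      simp [h']
    · rw [mul_zero]
      exact isWeightedHomogeneous_zero _ _ _
  | algebraMap r =>
    rw [AlgHom.commutes]
    exact isWeightedHomogeneous_C _ _
  | add x y _ _ hx hy => rw [map_add]; exact hx.add hy
  | mul x y _ _ hx hy => rw [map_mul]; simpa using hx.mul hy

lemma shiftQ_comp_succ (hl : l ≤ d) {e : ℕ} (he : e + 1 < d) {a : Sd k d ⧸ KK k d}
    (ha : a ∈ Rdl k d l) : shiftQ (comp k d (e + 1) a) = killQ (comp k d e a) := by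
  rw [Rdl_eq_adjoin hl] at ha
  induction ha using Algebra.adjoin_induction with
  | mem x hx =>
    obtain ⟨n, i, -, h2, h3, rfl⟩ := hx
    rw [comp_gen k d he h3 h2, comp_gen k d (by omega) h3 h2, levVal, levVal]
    split_ifs <;> first | omega | simp [shiftQ, killQ]
  | algebraMap r => simp only [AlgHom.commutes]
  | add x y _ _ hx hy => simp only [map_add, hx, hy]
  | mul x y _ _ hx hy => simp only [map_mul, hx, hy]

lemma sum_levVal (hl : l ≤ d) {e : ℕ} (he : e < d) (hle : d - l ≤ e) (f : ℕ → Coord k) :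
    ∑ i ∈ Finset.range (l + 1), f (d - i) * levVal k e (d - i) =
      f (e + 1) * X 2 + f e * X 3 := by
  have h : ∀ i ∈ Finset.range (l + 1), f (d - i) * levVal k e (d - i) =
      (if i = d - (e + 1) then f (e + 1) * X 2 else 0) + if i = d - e then f e * X 3 else 0 := by
    intro i hi
    have := Finset.mem_range.1 hi
    rw [levVal]
    by_cases h1 : d - i = e + 1
    · rw [if_pos h1, if_pos (by omega), if_neg (by omega), h1, add_zero]
    · rw [if_neg h1, if_neg (show i ≠ d - (e + 1) by omega), zero_add]
      by_cases h2 : d - i = e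
      · rw [if_pos h2, if_pos (by omega), h2]
      · rw [if_neg h2, if_neg (by omega), mul_zero]
  rw [Finset.sum_congr rfl h, Finset.sum_add_distrib, Finset.sum_ite_eq', Finset.sum_ite_eq',
    if_pos (Finset.mem_range.2 (by omega)), if_pos (Finset.mem_range.2 (by omega))]

lemma comp_uu (hl : l ≤ d) {e : ℕ} (he : e < d) (hle : d - l ≤ e) :
    comp k d e (uu k d l) = uCoord k e := by
  rw [uu, map_sum, uCoord, ← sum_levVal hl he hle fun n => X 0 ^ n]
  refine Finset.sum_congr rfl fun i _ => ?_
  have := comp_gen k d he (le_refl (d - i)) (Nat.sub_le d i)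
  rwa [gen, Nat.sub_self, pow_zero, mul_one] at this

lemma comp_vv (hl : l ≤ d) {e : ℕ} (he : e < d) (hle : d - l ≤ e) :
    comp k d e (vv k d l) = vCoord k e := by
  rw [vv, map_sum, vCoord, ← sum_levVal hl he hle fun n => X 1 ^ n]
  refine Finset.sum_congr rfl fun i _ => ?_
  have := comp_gen k d he (Nat.zero_le (d - i)) (Nat.sub_le d i)
  rwa [gen, Nat.sub_zero, pow_zero, one_mul] at this

lemma uu_mem_Rdl (hl : l ≤ d) : uu k d l ∈ Rdl k d l := by
  refine sum_mem fun i hi => ?_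
  have := Finset.mem_range.1 hi
  have h := gen_mem_Rdl (k := k) hl (show d - l ≤ d - i by omega) (Nat.sub_le d i) le_rfl
  rwa [gen, Nat.sub_self] at h

/-- A monomial in the generators with nonzero image under the `e`-th component map is a
standard one. -/
lemma comp_eq_zero_or_eq_word {e : ℕ} (he : e < d) {w : Sd k d ⧸ KK k d}
    (hw : w ∈ Submonoid.closure (gens k d l)) :
    comp k d e w = 0 ∨ ∃ a b i, i ≤ (e + 1) * a + e * b ∧ w = word k d (lev e a b) i := by
  induction hw using Submonoid.closure_induction_left with
  | one => exact Or.inr ⟨0, 0, 0, by simp, rfl⟩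
  | mul_left x hx y hy ih =>
    obtain ⟨n, i, -, h2, h3, rfl⟩ := hx
    rcases ih with ih | ⟨a, b, j, hj, rfl⟩
    · left; rw [map_mul, ih, mul_zero]
    · have hL : ∀ m ∈ lev e a b, m ≤ d := fun m hm => (le_of_mem_lev hm).trans he
      have hs := sum_lev e a b
      by_cases hn : n = e + 1
      · subst hn
        refine Or.inr ⟨a + 1, b, j + i, by rw [mul_add]; omega, ?_⟩
        rw [gen_mul_word k d h3 h2 _ hL (by omega), lev, lev, List.replicate_succ,
          List.cons_append]
      by_cases hn' : n = e
      · subst hn'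
        refine Or.inr ⟨a, b + 1, j + i, by rw [mul_add]; omega, ?_⟩
        rw [lev, gen_mul_word_append k d h3 h2 _ _ hL (hj.trans hs.ge), lev, List.replicate_succ]
      · left
        rw [map_mul, comp_gen k d he h3 h2, levVal, if_neg hn, if_neg hn', mul_zero, zero_mul]

lemma exists_comp_ne_zero (hl1 : 1 ≤ l) (hl : l ≤ d) {w : Sd k d ⧸ KK k d}
    (hw : w ∈ Submonoid.closure (gens k d l)) (hw0 : w ≠ 0) :
    ∃ e, d - l ≤ e ∧ e < d ∧ comp k d e w ≠ 0 := by
  classical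
  obtain ⟨s, hs, rfl⟩ := Submonoid.exists_multiset_of_mem_closure hw
  by_cases hex : ∃ n, d - l ≤ n ∧ n ≤ d ∧ ∃ i ≤ n, gen k d n i ∈ s
  · obtain ⟨h1, h2, i, hi, his⟩ := Nat.find_spec hex
    set n := Nat.find hex with hn
    have hx : ∀ e, e < d → n = e + 1 ∨ n = e → comp k d e (gen k d n i) ≠ 0 := by
      intro e he hne
      rw [comp_gen k d he hi h2]
      refine mul_ne_zero (mul_ne_zero (pow_ne_zero _ (X_ne_zero _))
        (pow_ne_zero _ (X_ne_zero _))) ?_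
      rw [levVal]
      split_ifs
      · exact X_ne_zero _
      · exact X_ne_zero _
      · omega
    refine ⟨min n (d - 1), by omega, by omega, fun h0 => hw0 ?_⟩
    have he : min n (d - 1) < d := by omega
    rw [map_multiset_prod, Multiset.prod_eq_zero_iff, Multiset.mem_map] at h0
    obtain ⟨y, hy, hy0⟩ := h0
    have hne : y ≠ gen k d n i := by
      rintro rfl
      exact hx _ he (by omega) hy0
    obtain ⟨n', i', h1', h2', h3', rfl⟩ := hs y hy
    have hmin : n ≤ n' := Nat.find_min' hex ⟨h1', h2', i', h3', hy⟩
    have hfar : n + 2 ≤ n' := by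
      by_contra hlt
      rw [comp_gen k d he h3' h2', levVal] at hy0
      split_ifs at hy0
      · simp at hy0
      · simp at hy0
      · omega
    rw [← Multiset.cons_erase his, Multiset.prod_cons,
      ← Multiset.cons_erase ((Multiset.mem_erase_of_ne hne).2 hy), Multiset.prod_cons, ← mul_assoc,
      gen_mul_gen_eq_zero k d hi h3' hfar h2', zero_mul]
  · have h0 : s = 0 := by
      refine Multiset.eq_zero_of_forall_notMem fun y hy => hex ?_
      obtain ⟨n, i, h1, h2, h3, rfl⟩ := hs y hy
      exact ⟨n, h1, h2, i, h3, hy⟩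
    exact ⟨d - 1, by omega, by omega, by simp [h0]⟩

lemma eq_zero_of_comp_eq_zero (hl1 : 1 ≤ l) (hl : l ≤ d) {a : Sd k d ⧸ KK k d}
    (ha : a ∈ Rdl k d l) (h : ∀ e, d - l ≤ e → e < d → comp k d e a = 0) : a = 0 := by
  rw [Rdl_eq_adjoin hl, ← Subalgebra.mem_toSubmodule, Algebra.adjoin_eq_span,
    Submodule.mem_span_iff_exists_finset_subset] at ha
  obtain ⟨c, T, hT, -, rfl⟩ := ha
  refine Finset.sum_eq_zero fun w hw => ?_
  by_cases hw0 : w = 0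
  · rw [hw0, smul_zero]
  obtain ⟨e, hle, he, hne⟩ := exists_comp_ne_zero hl1 hl (hT hw) hw0
  obtain ⟨a, b, i, hi, rfl⟩ := (comp_eq_zero_or_eq_word he (hT hw)).resolve_left hne
  have hc := congrArg (coeff (expo i ((e + 1) * a + e * b - i) a b)) (h e hle he)
  rw [map_sum, coeff_sum, Finset.sum_eq_single_of_mem _ hw, map_smul, comp_word_lev k d he hi,
    coeff_smul, coeff_monomial, if_pos rfl, coeff_zero, smul_eq_mul, mul_one] at hc
  · rw [hc, zero_smul]
  · intro w' hw' hww'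
    rw [map_smul, coeff_smul]
    rcases comp_eq_zero_or_eq_word he (hT hw') with h0 | ⟨a', b', i', hi', rfl⟩
    · rw [h0, coeff_zero, smul_zero]
    · rw [comp_word_lev k d he hi', coeff_monomial, if_neg, smul_zero]
      intro hexp
      have h0 := DFunLike.congr_fun hexp 0
      have h2 := DFunLike.congr_fun hexp 2
      have h3 := DFunLike.congr_fun hexp 3
      simp only [expo, Finsupp.equivFunOnFinite_symm_apply_apply, Matrix.cons_val] at h0 h2 h3
      exact hww' (by rw [h0, h2, h3])

/-- An element of a component that is compatible with zero on all higher components lifts. -/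
lemma exists_lift (hl : l ≤ d) {e : ℕ} (he : e < d) (hle : d - l ≤ e) {g : Coord k}
    (hg : IsWeightedHomogeneous (wt e) g 0) (h0 : e + 1 < d → killQ g = 0) :
    ∃ r ∈ Rdl k d l, comp k d e r = g ∧ ∀ f, e < f → f < d → comp k d f r = 0 := by
  have hwt : ∀ μ ∈ g.support, μ 0 + μ 1 = (e + 1) * μ 2 + e * μ 3 := by
    intro μ hμ
    have := hg (mem_support_iff.1 hμ)
    rw [weight_wt] at this
    zify
    linarith
  refine ⟨∑ μ ∈ g.support, coeff μ g • word k d (lev e (μ 2) (μ 3)) (μ 0),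
    sum_mem fun μ _ => Subalgebra.smul_mem _ (word_mem_Rdl hl (fun m hm => ?_) _) _, ?_, ?_⟩
  · have := le_of_mem_lev hm
    have h' : e ≤ m := by
      simp only [lev, List.mem_append, List.mem_replicate] at hm
      omega
    omega
  · rw [map_sum]
    conv_rhs => rw [as_sum g]
    refine Finset.sum_congr rfl fun μ hμ => ?_
    have := hwt μ hμ
    rw [map_smul, comp_word_lev k d he (by omega), smul_monomial, smul_eq_mul, mul_one, ← this,
      Nat.add_sub_cancel_left]
    exact congrArg (monomial · _) (Finsupp.ext fun i => by fin_cases i <;> simp [expo])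
  · intro f hef hf
    rw [map_sum]
    refine Finset.sum_eq_zero fun μ hμ => ?_
    have := hwt μ hμ
    rw [map_smul, comp_word_lev_of_lt k d hef hf
      (one_le_of_mem_support (h0 (by omega)) hμ) (by omega), smul_zero]

lemma exists_quotient (hl1 : 1 ≤ l) (hl : l ≤ d) {a : Sd k d ⧸ KK k d} (ha : a ∈ Rdl k d l)
    (h : ∀ e, d - l ≤ e → e < d → uCoord k e ∣ comp k d e a) :
    ∃ c ∈ Rdl k d l, a = c * uu k d l := by
  suffices H : ∀ j ≤ l, ∃ c ∈ Rdl k d l, ∀ e, d - j ≤ e → e < d →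
      comp k d e (a - c * uu k d l) = 0 by
    obtain ⟨c, hc, h'⟩ := H l le_rfl
    exact ⟨c, hc, sub_eq_zero.1 (eq_zero_of_comp_eq_zero hl1 hl
      (sub_mem ha (mul_mem hc (uu_mem_Rdl hl))) h')⟩
  intro j
  induction j with
  | zero => exact fun _ => ⟨0, zero_mem _, fun e h1 h2 => by omega⟩
  | succ j ih =>
    intro hj
    obtain ⟨c, hc, hz⟩ := ih (by omega)
    obtain ⟨e, hd⟩ : ∃ e, d = e + j + 1 := ⟨d - (j + 1), by omega⟩
    have he : e < d := by omega
    have hle : d - l ≤ e := by omega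
    have hR : a - c * uu k d l ∈ Rdl k d l := sub_mem ha (mul_mem hc (uu_mem_Rdl hl))
    obtain ⟨g₀, hg₀⟩ : uCoord k e ∣ comp k d e (a - c * uu k d l) := by
      rw [map_sub, map_mul, comp_uu hl he hle]
      exact dvd_sub (h e hle he) (dvd_mul_left _ _)
    obtain ⟨g, hg, hgu⟩ := exists_homogeneous_quotient e
      (isWeightedHomogeneous_comp hl he hR) (isWeightedHomogeneous_uCoord e)
      (hg₀.trans (mul_comm _ _))
    obtain ⟨r, hr, hr1, hr2⟩ := exists_lift hl he hle hg fun he1 => by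
      have hs := shiftQ_comp_succ hl he1 hR
      rw [hz (e + 1) (by omega) he1, map_zero, hgu, map_mul] at hs
      exact (mul_eq_zero.1 hs.symm).resolve_right (killQ_uCoord_ne_zero e)
    refine ⟨c + r, add_mem hc hr, fun f h1 h2 => ?_⟩
    rw [add_mul, ← sub_sub, map_sub, map_mul _ r]
    rcases (show e ≤ f by omega).eq_or_lt with rfl | hf
    · rw [hr1, comp_uu hl he hle, hgu, sub_self]
    · rw [hr2 f hf h2, hz f (by omega) h2, zero_mul, sub_zero]

end Generators

end RegularSequence

end

/-- Statement 17: for all `1 ≤ l ≤ d`, the pair `{u_{d,l}, v_{d,l}}` is a regular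
sequence in `R(d,l)`: `u_{d,l}` is a non-zero-divisor in `R(d,l)` and `v_{d,l}`
is a non-zero-divisor modulo the ideal of `R(d,l)` generated by `u_{d,l}`.
In particular (`l = d`), `{u_{d,d}, v_{d,d}}` is a regular sequence in the full
subalgebra `U = R(d,d)` generated by all the `m_{i,j,l}`. -/
theorem statement_17 (k : Type) [Field k] (d : ℕ) (hd : 2 ≤ d) :
    ∀ l : ℕ, 1 ≤ l → l ≤ d →
      (∀ a ∈ Rdl k d l, a * uu k d l = 0 → a = 0) ∧
      (∀ a ∈ Rdl k d l,
        (∃ b ∈ Rdl k d l, a * vv k d l = b * uu k d l) →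
        ∃ c ∈ Rdl k d l, a = c * uu k d l) := by
  intro l hl1 hl
  refine ⟨fun a ha h => ?_, fun a ha ⟨b, _, h⟩ => ?_⟩
  · refine RegularSequence.eq_zero_of_comp_eq_zero hl1 hl ha fun e hle he => ?_
    have := congrArg (RegularSequence.comp k d e) h
    rw [map_mul, map_zero, RegularSequence.comp_uu hl he hle] at this
    exact (mul_eq_zero.1 this).resolve_right (RegularSequence.uCoord_ne_zero e)
  · refine RegularSequence.exists_quotient hl1 hl ha fun e hle he => ?_
    have := congrArg (RegularSequence.comp k d e) h
    rw [map_mul, map_mul, RegularSequence.comp_uu hl he hle,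
      RegularSequence.comp_vv hl he hle] at this
    exact (RegularSequence.isRelPrime_uCoord_vCoord e).dvd_of_dvd_mul_right
      (this ▸ dvd_mul_left _ _)
end

section
/- Let k be a field and d ≥ 2. With S(d) = k[x_i,y_i,z_i : 0 ≤ i ≤ d−1], K(d) = (x_i y_{i+1} − y_i x_{i+1}, z_i x_{i+1}, z_i y_{i+1} : 0 ≤ i ≤ d−2), m_{i,j,l} the class of x_0⋯x_{i−1} y_i⋯y_{i+j−1} z_{i+j}⋯z_{d−1} in S(d)/K(d), and R(d,1) the k-subalgebra of S(d)/K(d) generated by {m_{i,d−i,0} : 0 ≤ i ≤ d} ∪ {m_{i,d−i−1,1} : 0 ≤ i ≤ d−1}, consider the R(d,1)-module map φ : R(d,1)^2 → R(d,1) given by φ(g,h) = g·m_{d,0,0} + h·m_{0,d,0}. Then the kernel of φ is generated as an R(d,1)-submodule of R(d,1)^2 by the element (m_{0,d,0}, −m_{d,0,0}) together with the elements (m_{0,d−1,1}·m_{j,d−j−1,1}, −m_{d−1,0,1}·m_{j+1,d−j−2,1}) for 0 ≤ j ≤ d−2. -/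
open MvPolynomial

section NormalForm

variable {B : Type*} [CommMonoid B] (c : Bool → ℕ) (g : Bool → ℕ → B)

/-- The product of one `g ε i` for each `ε` in the list, with the index total `n` distributed
greedily from the left, subject to the capacity `i ≤ c ε`. -/
def greedyProd : ℕ → List Bool → B
  | _, [] => 1
  | n, ε :: E => g ε (min n (c ε)) * greedyProd (n - c ε) E

/-- The quadratic relations saying that index mass can be moved between two factors. -/
def ExchangeRel : Prop :=
  ∀ ε δ i j, i < c ε → j < c δ → g ε i * g δ (j + 1) = g ε (i + 1) * g δ j

variable {c g}

theorem ExchangeRel.mul_greedyProd_succ (hex : ExchangeRel c g) (E : List Bool) :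
    ∀ (ε : Bool) (i n : ℕ), i < c ε → n < (E.map c).sum →
      g ε i * greedyProd c g (n + 1) E = g ε (i + 1) * greedyProd c g n E := by
  induction E with
  | nil => intro ε i n _ h; simp at h
  | cons δ E ih =>
    intro ε i n hi hn
    simp only [List.map_cons, List.sum_cons] at hn
    simp only [greedyProd]
    rcases lt_or_ge n (c δ) with h | h
    · rw [min_eq_left h, min_eq_left h.le, Nat.sub_eq_zero_of_le h, Nat.sub_eq_zero_of_le h.le,
        ← mul_assoc, hex _ _ _ _ hi h, mul_assoc]
    · rw [min_eq_right h, min_eq_right (by omega), Nat.sub_add_comm h, mul_left_comm,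
        ih ε i (n - c δ) hi (by omega), mul_left_comm]

theorem ExchangeRel.mul_greedyProd_add (hex : ExchangeRel c g) (E : List Bool) (ε : Bool)
    (i n j : ℕ) (hi : i + j ≤ c ε) (hn : n + j ≤ (E.map c).sum) :
    g ε i * greedyProd c g (n + j) E = g ε (i + j) * greedyProd c g n E := by
  induction j generalizing i with
  | zero => rfl
  | succ j ih =>
    rw [← add_assoc, hex.mul_greedyProd_succ E ε i (n + j) (by omega) (by omega),
      ih (i + 1) (by omega) (by omega)]
    congr 2
    omega

theorem ExchangeRel.mul_greedyProd (hex : ExchangeRel c g) (E : List Bool) (ε : Bool)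
    (i n : ℕ) (hi : i ≤ c ε) (hn : n ≤ (E.map c).sum) :
    g ε i * greedyProd c g n E = greedyProd c g (i + n) (ε :: E) := by
  rw [greedyProd]
  rcases le_total (i + n) (c ε) with h | h
  · rw [min_eq_left h, Nat.sub_eq_zero_of_le h]
    simpa using hex.mul_greedyProd_add E ε i 0 n h (by omega)
  · rw [min_eq_right h]
    have := hex.mul_greedyProd_add E ε i (i + n - c ε) (c ε - i) (by omega) (by omega)
    rwa [show i + n - c ε + (c ε - i) = n by omega, show i + (c ε - i) = c ε by omega] at this

theorem ExchangeRel.greedyProd_perm (hex : ExchangeRel c g) {E E' : List Bool} (h : E.Perm E') :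
    ∀ n ≤ (E.map c).sum, greedyProd c g n E = greedyProd c g n E' := by
  induction h with
  | nil => intro n _; rfl
  | cons ε _ ih =>
    intro n hn
    simp only [List.map_cons, List.sum_cons] at hn
    simp only [greedyProd]
    rw [ih _ (by omega)]
  | swap ε δ E =>
    intro n hn
    simp only [List.map_cons, List.sum_cons] at hn
    rw [greedyProd, greedyProd, mul_left_comm,
      hex.mul_greedyProd E δ _ _ (min_le_right _ _) (by omega),
      hex.mul_greedyProd (δ :: E) ε _ _ (min_le_right _ _) (by simp; omega)]
    congr 1
    omega
  | trans h₁ _ ih₁ ih₂ =>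
    intro n hn
    rw [ih₁ n hn, ih₂ n (by rwa [← (h₁.map c).sum_eq])]

theorem ExchangeRel.greedyProd_mul (hex : ExchangeRel c g) (E E' : List Bool) :
    ∀ n m, n ≤ (E.map c).sum → m ≤ (E'.map c).sum →
      greedyProd c g n E * greedyProd c g m E' = greedyProd c g (n + m) (E ++ E') := by
  induction E with
  | nil => intro n m hn _; simp at hn; simp [greedyProd, hn]
  | cons ε E ih =>
    intro n m hn hm
    simp only [List.map_cons, List.sum_cons] at hn
    rw [greedyProd, mul_assoc, ih _ _ (by omega) hm,
      hex.mul_greedyProd _ ε _ _ (min_le_right _ _) (by simp; omega), List.cons_append]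
    congr 1
    omega

end NormalForm

section Word

variable {B : Type*} [CommMonoid B] (X Y Z : ℕ → B)

/-- The product of the first `n` letters of the word `X⋯XY⋯YZ⋯Z`, with `X` in positions below `i`
and `Y` in positions from `i` up to `c`. -/
def wordProd (c i n : ℕ) : B :=
  ∏ t ∈ Finset.range n, if t < i then X t else if t < c then Y t else Z t

variable {X Y Z}

theorem wordProd_succ (c i n : ℕ) : wordProd X Y Z c i (n + 1) =
    wordProd X Y Z c i n * if n < i then X n else if n < c then Y n else Z n :=
  Finset.prod_range_succ _ _

theorem wordProd_exchange_of_lt {d : ℕ} (hXY : ∀ t, t + 1 < d → X t * Y (t + 1) = Y t * X (t + 1))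
    {c c' i j : ℕ} (hc : d ≤ c + 1) (hi : i < c) (hj : j < c') (hc' : c' ≤ d) (hij : i ≤ j) :
    wordProd X Y Z c i d * wordProd X Y Z c' (j + 1) d =
      wordProd X Y Z c (i + 1) d * wordProd X Y Z c' j d := by
  have start : ∀ n ≤ i, wordProd X Y Z c i n * wordProd X Y Z c' (j + 1) n =
      wordProd X Y Z c (i + 1) n * wordProd X Y Z c' j n := by
    intro n
    induction n with
    | zero => simp [wordProd]
    | succ n ih =>
      intro hn
      simp only [wordProd_succ]
      rw [if_pos (by omega : n < i), if_pos (by omega : n < j + 1), if_pos (by omega : n < i + 1),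
        if_pos (by omega : n < j), mul_mul_mul_comm, ih (by omega), mul_mul_mul_comm]
  have middle : ∀ n, i < n → n ≤ j → wordProd X Y Z c i n * wordProd X Y Z c' (j + 1) n * X n =
      wordProd X Y Z c (i + 1) n * wordProd X Y Z c' j n * Y n := by
    intro n hn
    induction n, hn using Nat.le_induction with
    | base =>
      intro hn
      have h := start i le_rfl
      have hx := hXY i (by omega)
      simp only [wordProd_succ]
      rw [if_neg (by omega : ¬ i < i), if_pos hi, if_pos (by omega : i < j + 1),
        if_pos (by omega : i < i + 1), if_pos (by omega : i < j), mul_mul_mul_comm, h,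
        mul_mul_mul_comm _ _ (wordProd X Y Z c' j i)]
      simp only [mul_assoc]
      rw [hx, mul_left_comm (Y i), ← hx]
    | succ n hn ih =>
      intro hnj
      have h := ih (by omega)
      have hx := hXY n (by omega)
      simp only [wordProd_succ]
      rw [if_neg (by omega : ¬ n < i), if_pos (by omega : n < c), if_pos (by omega : n < j + 1),
        if_neg (by omega : ¬ n < i + 1), if_pos (by omega : n < j), mul_mul_mul_comm,
        mul_comm (Y n), ← mul_assoc, h, mul_mul_mul_comm _ (Y n), mul_assoc, mul_assoc,
        mul_assoc (_ * _) (_ * _), mul_assoc (Y n), hx]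
  have finish : ∀ n, j < n → n ≤ d → wordProd X Y Z c i n * wordProd X Y Z c' (j + 1) n =
      wordProd X Y Z c (i + 1) n * wordProd X Y Z c' j n := by
    intro n hn
    induction n, hn using Nat.le_induction with
    | base =>
      intro hn
      simp only [wordProd_succ]
      rw [if_pos (by omega : j < j + 1), if_neg (by omega : ¬ j < j), if_pos hj]
      rcases hij.eq_or_lt with rfl | hlt
      · rw [if_neg (by omega : ¬ i < i), if_pos hi, if_pos (by omega : i < i + 1)]
        rw [mul_mul_mul_comm, start i le_rfl, mul_comm (Y i), ← mul_mul_mul_comm]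
      · rw [if_neg (by omega : ¬ j < i), if_neg (by omega : ¬ j < i + 1), mul_mul_mul_comm,
          mul_comm _ (X j), ← mul_assoc, middle j hlt le_rfl, mul_assoc, mul_comm (Y j),
          mul_mul_mul_comm]
    | succ n hn ih =>
      intro hnd
      simp only [wordProd_succ]
      rw [if_neg (by omega : ¬ n < i), if_neg (by omega : ¬ n < j + 1),
        if_neg (by omega : ¬ n < i + 1), if_neg (by omega : ¬ n < j), mul_mul_mul_comm,
        ih (by omega), mul_mul_mul_comm]
  exact finish d (by omega) le_rfl

end Word

noncomputable section

variable (k : Type) [Field k] (d : ℕ)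

/-- The number of letters `x`, `y` in a generator of `R(d,1)`; `true` marks the generators ending
in `z`. -/
def genCap (ε : Bool) : ℕ := bif ε then d - 1 else d

@[simp] theorem genCap_true : genCap d true = d - 1 := rfl

@[simp] theorem genCap_false : genCap d false = d := rfl

/-- The generators `m_{i,d-i,0}` (for `ε = false`) and `m_{i,d-1-i,1}` (for `ε = true`). -/
def gen (ε : Bool) (i : ℕ) : Sd k d ⧸ KK k d := mm k d i (genCap d ε - i)

/-- The class of the variable `X (t, a)`, extended by `1` to all `t : ℕ`. -/
def letter (a : Fin 3) (t : ℕ) : Sd k d ⧸ KK k d :=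
  if h : t < d then Ideal.Quotient.mk (KK k d) (X (⟨t, h⟩, a)) else 1

theorem mm_eq_wordProd (i j : ℕ) :
    mm k d i j = wordProd (letter k d 0) (letter k d 1) (letter k d 2) (i + j) i d := by
  rw [mm, wordProd, Finset.prod_range, map_prod]
  refine Finset.prod_congr rfl fun t _ => ?_
  simp only [letter, t.isLt, dite_true, xv, yv, zv]
  split_ifs <;> rfl

theorem letter_exchange (t : ℕ) (ht : t + 1 < d) :
    letter k d 0 t * letter k d 1 (t + 1) = letter k d 1 t * letter k d 0 (t + 1) := by
  simp only [letter, ht, (by omega : t < d), dite_true]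
  rw [← map_mul, ← map_mul, Ideal.Quotient.eq]
  exact Ideal.subset_span ⟨t, ht, Or.inl rfl⟩

theorem gen_eq_wordProd (ε : Bool) (i : ℕ) (hi : i ≤ genCap d ε) : gen k d ε i =
    wordProd (letter k d 0) (letter k d 1) (letter k d 2) (genCap d ε) i d := by
  rw [gen, mm_eq_wordProd, Nat.add_sub_cancel' hi]

theorem exchangeRel_gen : ExchangeRel (genCap d) (gen k d) := by
  intro ε δ i j hi hj
  have hcap : ∀ ε, genCap d ε ≤ d ∧ d ≤ genCap d ε + 1 := by
    rintro (_ | _) <;> simp; omega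
  rw [gen_eq_wordProd k d ε i hi.le, gen_eq_wordProd k d ε (i + 1) hi,
    gen_eq_wordProd k d δ j hj.le, gen_eq_wordProd k d δ (j + 1) hj]
  rcases le_total i j with h | h
  · exact wordProd_exchange_of_lt (letter_exchange k d) (hcap ε).2 hi hj (hcap δ).1 h
  · rw [mul_comm, mul_comm (wordProd _ _ _ _ (i + 1) _)]
    exact (wordProd_exchange_of_lt (letter_exchange k d) (hcap δ).2 hj hi (hcap ε).1 h).symm

/-- The homomorphism `S(d)/K(d) → k[x,y,t,w]` sending `m_{i,d-i,0}` to `x^i y^(d-i) t` and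
`m_{i,d-1-i,1}` to `x^i y^(d-1-i) w`. -/
def toPoly : (Sd k d ⧸ KK k d) →ₐ[k] MvPolynomial (Fin 4) k :=
  Ideal.Quotient.liftₐ (KK k d)
    (aeval fun p : Fin d × Fin 3 =>
      if (p.1 : ℕ) + 1 = d then ![X 0 * X 2, X 1 * X 2, X 3] p.2 else ![X 0, X 1, 0] p.2) <| by
    intro a ha
    rw [← RingHom.mem_ker]
    revert a
    change KK k d ≤ _
    refine Ideal.span_le.2 ?_
    rintro p ⟨i, hi, hp⟩
    have : ¬ i + 1 = d := by omega
    rcases hp with rfl | rfl | rfl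
    · simp only [SetLike.mem_coe, RingHom.mem_ker, xv, yv]
      simp [this]
      split_ifs <;> ring
    · simp [RingHom.mem_ker, xv, zv, this]
    · simp [RingHom.mem_ker, yv, zv, this]

theorem prod_range_ite_lt {M : Type*} [CommMonoid M] (a b : M) (n i : ℕ) (hi : i ≤ n) :
    ∏ t ∈ Finset.range n, (if t < i then a else b) = a ^ i * b ^ (n - i) := by
  rw [← Finset.prod_range_mul_prod_Ico _ hi,
    Finset.prod_congr rfl fun t ht => if_pos (Finset.mem_range.1 ht),
    Finset.prod_congr rfl fun t ht => if_neg (Finset.mem_Ico.1 ht).1.not_gt]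
  simp

theorem toPoly_letter (a : Fin 3) (t : ℕ) (ht : t < d) : toPoly k d (letter k d a t) =
    if t + 1 = d then ![X 0 * X 2, X 1 * X 2, X 3] a else ![X 0, X 1, 0] a := by
  rw [letter, dif_pos ht]
  exact aeval_X _ _

theorem toPoly_gen (hd : 1 ≤ d) (ε : Bool) (i : ℕ) (hi : i ≤ genCap d ε) :
    toPoly k d (gen k d ε i) =
      X 0 ^ i * X 1 ^ (genCap d ε - i) * bif ε then X 3 else X 2 := by
  obtain ⟨d, rfl⟩ : ∃ e, d = e + 1 := ⟨d - 1, by omega⟩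
  have hcap : d ≤ genCap (d + 1) ε := by cases ε <;> simp
  rw [gen_eq_wordProd k _ ε i hi, wordProd_succ, map_mul, wordProd, map_prod,
    Finset.prod_congr rfl (g := fun t => if t < i then X 0 else X 1) fun t ht => ?_]
  · rcases Nat.lt_or_ge d i with h | h
    · rw [if_pos h, toPoly_letter _ _ _ _ (Nat.lt_succ_self d), if_pos rfl,
        Finset.prod_congr rfl fun t ht =>
          if_pos ((Finset.mem_range.1 ht).trans h)]
      cases ε
      · obtain rfl : i = d + 1 := le_antisymm hi h
        simp [pow_succ, mul_assoc]
      · simp at hi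
        omega
    · rw [if_neg h.not_gt, prod_range_ite_lt _ _ _ _ h]
      cases ε
      · rw [if_pos (by simp), toPoly_letter _ _ _ _ (Nat.lt_succ_self d), if_pos rfl]
        simp [Nat.succ_sub h, pow_succ, mul_assoc]
      · rw [if_neg (by simp), toPoly_letter _ _ _ _ (Nat.lt_succ_self d), if_pos rfl]
        simp
  · have ht := Finset.mem_range.1 ht
    rw [if_pos (ht.trans_le hcap), apply_ite (toPoly k (d + 1)),
      toPoly_letter _ _ _ _ (by omega), toPoly_letter _ _ _ _ (by omega)]
    simp [ht.ne]

/-- The total capacity of a list of generator types. -/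
abbrev listCap (E : List Bool) : ℕ := (E.map (genCap d)).sum

theorem toPoly_greedyProd (hd : 1 ≤ d) (E : List Bool) : ∀ n ≤ listCap d E,
    toPoly k d (greedyProd (genCap d) (gen k d) n E) =
      X 0 ^ n * X 1 ^ (listCap d E - n) * X 2 ^ E.count false * X 3 ^ E.count true := by
  induction E with
  | nil => intro n hn; obtain rfl := Nat.le_zero.1 hn; simp [greedyProd, listCap]
  | cons ε E ih =>
    intro n hn
    simp only [listCap, List.map_cons, List.sum_cons] at hn ih ⊢
    rw [greedyProd, map_mul, toPoly_gen k d hd ε _ (min_le_right _ _), ih _ (by omega)]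
    have h₁ : min n (genCap d ε) + (n - genCap d ε) = n := by omega
    have h₂ : (genCap d ε - min n (genCap d ε)) +
      ((E.map (genCap d)).sum - (n - genCap d ε)) = genCap d ε + (E.map (genCap d)).sum - n := by
      omega
    rw [← h₂]
    nth_rw 5 [← h₁]
    cases ε <;> simp <;> ring

/-- The list of generator types with `p` generators `m_{i,d-i,0}` and `q` generators
`m_{i,d-1-i,1}`. -/
abbrev typeList (p q : ℕ) : List Bool := List.replicate p false ++ List.replicate q true

theorem listCap_typeList (p q : ℕ) : listCap d (typeList p q) = d * p + (d - 1) * q := by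
  simp [listCap, mul_comm]

theorem perm_typeList (E : List Bool) : E.Perm (typeList (E.count false) (E.count true)) := by
  rw [List.perm_iff_count]
  rintro (_ | _) <;> simp [List.count_append, List.count_replicate]

/-- The monomial of `R(d,1)` with image `x^n y^(dp+(d-1)q-n) t^p w^q`. -/
def normalForm (n p q : ℕ) : Sd k d ⧸ KK k d :=
  greedyProd (genCap d) (gen k d) n (typeList p q)

theorem toPoly_normalForm (hd : 1 ≤ d) (n p q : ℕ) (hn : n ≤ d * p + (d - 1) * q) :
    toPoly k d (normalForm k d n p q) =
      X 0 ^ n * X 1 ^ (d * p + (d - 1) * q - n) * X 2 ^ p * X 3 ^ q := by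
  rw [← listCap_typeList] at hn ⊢
  rw [normalForm, toPoly_greedyProd k d hd _ n hn]
  simp [List.count_append, List.count_replicate]

theorem gen_mem_Rdl (ε : Bool) (i : ℕ) (hi : i ≤ genCap d ε) : gen k d ε i ∈ Rdl k d 1 := by
  apply Algebra.subset_adjoin
  cases ε
  · exact ⟨0, by simp, i, hi, by simp [gen]⟩
  · exact ⟨1, le_rfl, i, hi, by rw [gen, genCap_true, Nat.sub_right_comm]⟩

theorem greedyProd_mem_Rdl (E : List Bool) :
    ∀ n, greedyProd (genCap d) (gen k d) n E ∈ Rdl k d 1 := by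
  induction E with
  | nil => intro n; exact one_mem _
  | cons ε E ih => intro n; exact mul_mem (gen_mem_Rdl k d ε _ (min_le_right _ _)) (ih _)

theorem normalForm_mem_Rdl (n p q : ℕ) : normalForm k d n p q ∈ Rdl k d 1 :=
  greedyProd_mem_Rdl k d _ _

theorem mem_span_normalForm {r : Sd k d ⧸ KK k d} (hr : r ∈ Rdl k d 1) :
    r ∈ Submodule.span k {r | ∃ n p q, n ≤ d * p + (d - 1) * q ∧ r = normalForm k d n p q} := by
  rw [Rdl, ← Subalgebra.mem_toSubmodule, Algebra.adjoin_eq_span] at hr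
  refine Submodule.span_mono ?_ hr
  intro r hr
  suffices ∃ E, ∃ n ≤ listCap d E, r = greedyProd (genCap d) (gen k d) n E by
    obtain ⟨E, n, hn, rfl⟩ := this
    have hE := perm_typeList E
    refine ⟨n, E.count false, E.count true, ?_, (exchangeRel_gen k d).greedyProd_perm hE n hn⟩
    rwa [← listCap_typeList, listCap, ← (hE.map _).sum_eq]
  induction hr using Submonoid.closure_induction with
  | mem r hr =>
    obtain ⟨j, hj, i, hi, rfl⟩ := hr
    obtain ⟨ε, hε⟩ : ∃ ε, genCap d ε = d - j := by
      interval_cases j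
      exacts [⟨false, rfl⟩, ⟨true, rfl⟩]
    refine ⟨[ε], i, by simp [listCap, hε, hi], ?_⟩
    simp [greedyProd, gen, hε, hi, Nat.sub_right_comm]
  | one => exact ⟨[], 0, by simp, rfl⟩
  | mul r s _ _ hr hs =>
    obtain ⟨E, n, hn, rfl⟩ := hr
    obtain ⟨F, m, hm, rfl⟩ := hs
    refine ⟨E ++ F, n + m, ?_, (exchangeRel_gen k d).greedyProd_mul E F n m hn hm⟩
    simp only [listCap, List.map_append, List.sum_append] at *
    omega

/-- A linear section of `toPoly` on `R(d,1)`. -/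
def ofPoly : MvPolynomial (Fin 4) k →ₗ[k] Sd k d ⧸ KK k d :=
  (basisMonomials (Fin 4) k).constr k fun m => normalForm k d (m 0) (m 2) (m 3)

/-- The exponent of the monomial `x^a y^b t^p w^q`. -/
def expo (a b p q : ℕ) : Fin 4 →₀ ℕ := Finsupp.equivFunOnFinite.symm ![a, b, p, q]

theorem monomial_expo (a b p q : ℕ) (r : k) :
    monomial (expo a b p q) r = C r * (X 0 ^ a * X 1 ^ b * X 2 ^ p * X 3 ^ q) := by
  rw [monomial_eq, Finsupp.prod_fintype _ _ (by simp), Fin.prod_univ_four]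
  rfl

theorem expo_eta (m : Fin 4 →₀ ℕ) : expo (m 0) (m 1) (m 2) (m 3) = m := by
  ext i
  fin_cases i <;> rfl

theorem toPoly_normalForm_eq_monomial (hd : 1 ≤ d) (n p q : ℕ) (hn : n ≤ d * p + (d - 1) * q) :
    toPoly k d (normalForm k d n p q) =
      monomial (expo n (d * p + (d - 1) * q - n) p q) 1 := by
  rw [toPoly_normalForm k d hd n p q hn, monomial_expo, C_1, one_mul]

theorem ofPoly_toPoly (hd : 1 ≤ d) {r : Sd k d ⧸ KK k d} (hr : r ∈ Rdl k d 1) :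
    ofPoly k d (toPoly k d r) = r := by
  replace hr := mem_span_normalForm k d hr
  induction hr using Submodule.span_induction with
  | mem r hr =>
    obtain ⟨n, p, q, hn, rfl⟩ := hr
    rw [toPoly_normalForm_eq_monomial k d hd n p q hn]
    exact (basisMonomials (Fin 4) k).constr_basis k _ _
  | zero => simp
  | add r s _ _ hr hs => rw [map_add, map_add, hr, hs]
  | smul a r _ hr => rw [map_smul, map_smul, hr]

theorem toPoly_injOn (hd : 1 ≤ d) : Set.InjOn (toPoly k d) (Rdl k d 1) := fun r hr s hs h => by
  rw [← ofPoly_toPoly k d hd hr, h, ofPoly_toPoly k d hd hs]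

theorem degree_of_mem_support_toPoly (hd : 1 ≤ d) {r : Sd k d ⧸ KK k d} (hr : r ∈ Rdl k d 1)
    (m : Fin 4 →₀ ℕ) (hm : coeff m (toPoly k d r) ≠ 0) :
    m 0 + m 1 = d * m 2 + (d - 1) * m 3 := by
  contrapose! hm
  replace hr := mem_span_normalForm k d hr
  induction hr using Submodule.span_induction with
  | mem r hr =>
    obtain ⟨n, p, q, hn, rfl⟩ := hr
    rw [toPoly_normalForm_eq_monomial k d hd n p q hn, coeff_monomial, if_neg]
    rintro rfl
    exact hm (Nat.add_sub_cancel' hn)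
  | zero => simp
  | add r s _ _ hr hs => rw [map_add, coeff_add, hr, hs, add_zero]
  | smul a r _ hr => rw [map_smul, coeff_smul, hr, smul_zero]

/-- `(g, h)` is an `R(d,1)`-linear combination of the listed generators of the kernel. -/
def IsSyzygyComb (g h : Sd k d ⧸ KK k d) : Prop :=
  ∃ c ∈ Rdl k d 1, ∃ cf : ℕ → (Sd k d ⧸ KK k d),
    (∀ j : ℕ, j ≤ d - 2 → cf j ∈ Rdl k d 1) ∧
    g = c * mm k d 0 d +
      ∑ j ∈ Finset.range (d - 1), cf j * (mm k d 0 (d - 1) * mm k d j (d - j - 1)) ∧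
    h = -(c * mm k d d 0) -
      ∑ j ∈ Finset.range (d - 1), cf j * (mm k d (d - 1) 0 * mm k d (j + 1) (d - j - 2))

variable {k d}

theorem IsSyzygyComb.zero : IsSyzygyComb k d 0 0 :=
  ⟨0, zero_mem _, 0, fun _ _ => zero_mem _, by simp, by simp⟩

theorem IsSyzygyComb.add {g h g' h' : Sd k d ⧸ KK k d} (H : IsSyzygyComb k d g h)
    (H' : IsSyzygyComb k d g' h') : IsSyzygyComb k d (g + g') (h + h') := by
  obtain ⟨c, hc, cf, hcf, rfl, rfl⟩ := H
  obtain ⟨c', hc', cf', hcf', rfl, rfl⟩ := H'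
  refine ⟨c + c', add_mem hc hc', cf + cf', fun j hj => add_mem (hcf j hj) (hcf' j hj), ?_, ?_⟩
  · simp only [Pi.add_apply, add_mul, Finset.sum_add_distrib]
    ring
  · simp only [Pi.add_apply, add_mul, Finset.sum_add_distrib]
    ring

variable (k d)

theorem mm_zero_right : mm k d d 0 = gen k d false d := by simp [gen]

theorem mm_zero_left : mm k d 0 d = gen k d false 0 := by simp [gen]

theorem mm_pred_zero_right : mm k d (d - 1) 0 = gen k d true (d - 1) := by simp [gen]

theorem mm_pred_zero_left : mm k d 0 (d - 1) = gen k d true 0 := by simp [gen]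

theorem mm_sub_sub_one (j : ℕ) : mm k d j (d - j - 1) = gen k d true j := by
  rw [gen, genCap_true, Nat.sub_right_comm]

theorem mm_succ_sub_sub_two (j : ℕ) :
    mm k d (j + 1) (d - j - 2) = gen k d true (j + 1) := by
  rw [gen, genCap_true, show d - j - 2 = d - 1 - (j + 1) by omega]

variable {k d}

theorem IsSyzygyComb.mem {g h : Sd k d ⧸ KK k d} (H : IsSyzygyComb k d g h) :
    g ∈ Rdl k d 1 ∧ h ∈ Rdl k d 1 := by
  obtain ⟨c, hc, cf, hcf, rfl, rfl⟩ := H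
  simp only [mm_zero_right, mm_zero_left, mm_pred_zero_right, mm_pred_zero_left, mm_sub_sub_one,
    mm_succ_sub_sub_two]
  constructor
  · refine add_mem (mul_mem hc (gen_mem_Rdl k d _ _ (by simp))) (sum_mem fun j hj => ?_)
    have hj := Finset.mem_range.1 hj
    exact mul_mem (hcf j (by omega))
      (mul_mem (gen_mem_Rdl k d _ _ (by simp)) (gen_mem_Rdl k d _ _ (by simp; omega)))
  · refine sub_mem (neg_mem (mul_mem hc (gen_mem_Rdl k d _ _ (by simp)))) (sum_mem fun j hj => ?_)
    have hj := Finset.mem_range.1 hj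
    exact mul_mem (hcf j (by omega))
      (mul_mem (gen_mem_Rdl k d _ _ (by simp)) (gen_mem_Rdl k d _ _ (by simp; omega)))

theorem IsSyzygyComb.eq_zero (hd : 1 ≤ d) {g h : Sd k d ⧸ KK k d} (H : IsSyzygyComb k d g h) :
    g * mm k d d 0 + h * mm k d 0 d = 0 := by
  have hmem := H.mem
  rw [mm_zero_right, mm_zero_left]
  refine toPoly_injOn k d hd (add_mem (mul_mem hmem.1 (gen_mem_Rdl k d _ _ (by simp)))
    (mul_mem hmem.2 (gen_mem_Rdl k d _ _ (by simp)))) (zero_mem _) ?_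
  obtain ⟨c, hc, cf, hcf, rfl, rfl⟩ := H
  simp only [mm_zero_right, mm_zero_left, mm_pred_zero_right, mm_pred_zero_left, mm_sub_sub_one,
    mm_succ_sub_sub_two]
  have key : ∀ j ∈ Finset.range (d - 1),
      toPoly k d (gen k d true 0 * gen k d true j * gen k d false d) =
        toPoly k d (gen k d true (d - 1) * gen k d true (j + 1) * gen k d false 0) := by
    intro j hj
    have hj := Finset.mem_range.1 hj
    obtain ⟨e, rfl⟩ : ∃ e, d = j + e + 2 := ⟨d - j - 2, by omega⟩
    simp only [map_mul]
    rw [toPoly_gen _ _ hd _ _ (by simp), toPoly_gen _ _ hd _ _ (by simp; omega),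
      toPoly_gen _ _ hd _ _ (by simp), toPoly_gen _ _ hd _ _ (by simp),
      toPoly_gen _ _ hd _ _ (by simp), toPoly_gen _ _ hd _ _ (by simp)]
    simp only [genCap_true, genCap_false, cond_true, cond_false]
    rw [show j + e + 2 - 1 = j + e + 1 by omega, show j + e + 1 - j = e + 1 by omega,
      show j + e + 1 - (j + 1) = e by omega]
    simp
    ring
  rw [map_zero, add_mul, sub_mul, Finset.sum_mul, Finset.sum_mul]
  simp only [map_add, map_sub, map_sum]
  rw [Finset.sum_congr rfl (g := fun j => toPoly k d (cf j * (gen k d true (d - 1) *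
    gen k d true (j + 1)) * gen k d false 0)) fun j hj => ?_]
  · simp only [map_mul, map_neg]
    ring
  · rw [mul_assoc, map_mul, key j hj, ← map_mul]
    simp only [mul_assoc]

theorem IsSyzygyComb.exists_monomial (hd : 2 ≤ d) (a : k) {n m p q : ℕ}
    (hdeg : n + m + d = d * p + (d - 1) * q) : ∃ g h, IsSyzygyComb k d g h ∧
      toPoly k d g = monomial (expo n m p q) a * X 1 ^ d ∧
      toPoly k d h = -(monomial (expo n m p q) a * X 0 ^ d) := by
  have hd' : 1 ≤ d := by omega
  rcases p with _ | p
  · obtain ⟨e, rfl⟩ : ∃ e, d = e + 2 := ⟨d - 2, by omega⟩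
    obtain ⟨q, rfl⟩ : ∃ r, q = r + 2 := by
      rcases q with _ | _ | q
      · simp at hdeg
      · simp at hdeg
        omega
      · exact ⟨q, rfl⟩
    have hdeg' : n + m = (e + 1) * q + e := by
      rw [show e + 2 - 1 = e + 1 from rfl] at hdeg
      linarith
    obtain ⟨j, r, rfl, hj, hr⟩ : ∃ j r, n = j + r ∧ j ≤ e ∧ r ≤ (e + 1) * q :=
      ⟨min n e, n - e, by omega, by omega, by omega⟩
    have hm : m = (e + 1) * q - r + (e - j) := by omega
    have hg : (e + 2 - 1 - j) = e - j + 1 := by omega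
    have hh : (e + 2 - 1 - (j + 1)) = e - j := by omega
    refine ⟨_, _, ⟨0, zero_mem _, Pi.single j (algebraMap k _ a * normalForm k _ r 0 q), ?_,
      rfl, rfl⟩, ?_, ?_⟩
    · intro i _
      rw [Pi.single_apply]
      split_ifs
      · exact mul_mem (Subalgebra.algebraMap_mem _ _) (normalForm_mem_Rdl _ _ _ _ _)
      · exact zero_mem _
    · rw [Finset.sum_eq_single j (fun i _ hi => by simp [hi]) (fun hj' => by simp at hj'; omega),
        mm_pred_zero_left, mm_sub_sub_one, zero_mul, zero_add, Pi.single_eq_same]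
      simp only [map_mul]
      rw [toPoly_gen _ _ hd' _ _ (by simp), toPoly_gen _ _ hd' _ _ (by simp; omega),
        toPoly_normalForm _ _ hd' _ _ _ (by simpa using hr), AlgHom.commutes, monomial_expo, hm]
      simp only [genCap_true, hg, cond_true, MvPolynomial.algebraMap_eq]
      simp
      obtain ⟨f, rfl⟩ := Nat.exists_eq_add_of_le hj
      ring
    · rw [Finset.sum_eq_single j (fun i _ hi => by simp [hi]) (fun hj' => by simp at hj'; omega),
        mm_pred_zero_right, mm_succ_sub_sub_two, zero_mul, neg_zero, zero_sub, Pi.single_eq_same]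
      simp only [map_mul, map_neg]
      rw [toPoly_gen _ _ hd' _ _ (by simp), toPoly_gen _ _ hd' _ _ (by simp; omega),
        toPoly_normalForm _ _ hd' _ _ _ (by simpa using hr), AlgHom.commutes, monomial_expo, hm]
      simp only [genCap_true, hh, cond_true, MvPolynomial.algebraMap_eq]
      simp
      ring
  · have hdeg' : n + m = d * p + (d - 1) * q := by linarith
    refine ⟨_, _, ⟨algebraMap k _ a * normalForm k d n p q,
      mul_mem (Subalgebra.algebraMap_mem _ _) (normalForm_mem_Rdl _ _ _ _ _), 0,
      fun _ _ => zero_mem _, rfl, rfl⟩, ?_, ?_⟩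
    · simp only [Pi.zero_apply, zero_mul, Finset.sum_const_zero, add_zero, mm_zero_left, map_mul]
      rw [toPoly_gen _ _ hd' _ _ (by simp), toPoly_normalForm _ _ hd' _ _ _ (by omega),
        AlgHom.commutes, monomial_expo, ← hdeg', Nat.add_sub_cancel_left]
      simp
      ring
    · simp only [Pi.zero_apply, zero_mul, Finset.sum_const_zero, sub_zero, mm_zero_right, map_mul,
        map_neg]
      rw [toPoly_gen _ _ hd' _ _ (by simp), toPoly_normalForm _ _ hd' _ _ _ (by omega),
        AlgHom.commutes, monomial_expo, ← hdeg', Nat.add_sub_cancel_left]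
      simp
      ring

theorem IsSyzygyComb.exists_of_degree (hd : 2 ≤ d) (f : MvPolynomial (Fin 4) k)
    (hf : ∀ m, coeff m f ≠ 0 → m 0 + m 1 + d = d * m 2 + (d - 1) * m 3) :
    ∃ g h, IsSyzygyComb k d g h ∧ toPoly k d g = f * X 1 ^ d ∧
      toPoly k d h = -(f * X 0 ^ d) := by
  rw [← support_sum_monomial_coeff f]
  refine Finset.sum_induction (fun m => monomial m (coeff m f))
    (fun f => ∃ g h, IsSyzygyComb k d g h ∧ toPoly k d g = f * X 1 ^ d ∧
      toPoly k d h = -(f * X 0 ^ d)) ?_ ⟨0, 0, .zero, by simp, by simp⟩ fun m hm => ?_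
  · rintro f f' ⟨g, h, H, hg, hh⟩ ⟨g', h', H', hg', hh'⟩
    refine ⟨g + g', h + h', H.add H', ?_, ?_⟩
    · rw [map_add, hg, hg', add_mul]
    · rw [map_add, hh, hh', add_mul, neg_add]
  · have := IsSyzygyComb.exists_monomial hd (coeff m f) (hf m (mem_support_iff.1 hm))
    rwa [expo_eta] at this

theorem isSyzygyComb_of_eq_zero (hd : 2 ≤ d) {g h : Sd k d ⧸ KK k d} (hg : g ∈ Rdl k d 1)
    (hh : h ∈ Rdl k d 1) (H : g * mm k d d 0 + h * mm k d 0 d = 0) : IsSyzygyComb k d g h := by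
  have hd' : 1 ≤ d := by omega
  have hX (i : Fin 4) : (X i : MvPolynomial (Fin 4) k) ≠ 0 := X_ne_zero i
  have H' := congrArg (toPoly k d) H
  rw [mm_zero_right, mm_zero_left, map_add, map_mul, map_mul, toPoly_gen _ _ hd' _ _ (by simp),
    toPoly_gen _ _ hd' _ _ (by simp), map_zero] at H'
  simp only [genCap_false, Nat.sub_self, pow_zero, mul_one, one_mul, Nat.sub_zero,
    cond_false] at H'
  have H₂ : toPoly k d g * X 0 ^ d = -toPoly k d h * X 1 ^ d := by
    apply mul_right_cancel₀ (hX 2)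
    linear_combination H'
  have hdvd : (X 1 : MvPolynomial (Fin 4) k) ^ d ∣ toPoly k d g := by
    have hprime : Prime (X 1 : MvPolynomial (Fin 4) k) := X_prime
    refine hprime.pow_dvd_of_dvd_mul_right d (fun h => ?_) (Dvd.intro_left _ H₂.symm)
    exact absurd (X_dvd_X.1 (hprime.dvd_of_dvd_pow h)) (by simp)
  obtain ⟨f, hf⟩ := hdvd
  have hfh : toPoly k d h = -(f * X 0 ^ d) := by
    apply mul_right_cancel₀ (pow_ne_zero d (hX 1))
    rw [hf] at H₂
    linear_combination H₂
  obtain ⟨g', h', K, hg', hh'⟩ := IsSyzygyComb.exists_of_degree hd f fun m hm => by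
    have := degree_of_mem_support_toPoly k d hd' hg (m + Finsupp.single 1 d) (by
      rwa [hf, mul_comm, X_pow_eq_monomial, coeff_mul_monomial, mul_one])
    simpa [add_assoc] using this
  have hK := K.mem
  rwa [toPoly_injOn k d hd' hg hK.1 (by rw [hg', hf, mul_comm]),
    toPoly_injOn k d hd' hh hK.2 (by rw [hh', hfh])]

end

/-- Statement 18: the kernel of the `R(d,1)`-module map
`φ : R(d,1)² → R(d,1)`, `φ(g,h) = g·m_{d,0,0} + h·m_{0,d,0}`, is generated as an
`R(d,1)`-submodule of `R(d,1)²` by `(m_{0,d,0}, −m_{d,0,0})` together with the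
elements `(m_{0,d−1,1}·m_{j,d−j−1,1}, −m_{d−1,0,1}·m_{j+1,d−j−2,1})` for
`0 ≤ j ≤ d−2`.  Equivalently (elementwise): a pair `(g,h)` of elements of
`R(d,1)` lies in the kernel iff it is an `R(d,1)`-linear combination of the
listed generators. -/
theorem statement_18 (k : Type) [Field k] (d : ℕ) (hd : 2 ≤ d) :
    ∀ g ∈ Rdl k d 1, ∀ h ∈ Rdl k d 1,
      (g * mm k d d 0 + h * mm k d 0 d = 0 ↔
        ∃ c ∈ Rdl k d 1, ∃ cf : ℕ → (Sd k d ⧸ KK k d),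
          (∀ j : ℕ, j ≤ d - 2 → cf j ∈ Rdl k d 1) ∧
          g = c * mm k d 0 d +
            ∑ j ∈ Finset.range (d - 1), cf j * (mm k d 0 (d - 1) * mm k d j (d - j - 1)) ∧
          h = -(c * mm k d d 0) -
            ∑ j ∈ Finset.range (d - 1),
              cf j * (mm k d (d - 1) 0 * mm k d (j + 1) (d - j - 2))) :=
  fun _ hg _ hh => ⟨isSyzygyComb_of_eq_zero hd hg hh, IsSyzygyComb.eq_zero (by omega)⟩
end
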